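/- arXiv:1203.2996 — 2 statements merged into one kernel-verified Lean document; each statement's English description precedes it below -/
import Mathlib

section
/- Let s, t ≥ 0 with s + t = 1, and let θ ∈ ℝ satisfy inf_{q ∈ ℕ, q ≥ 1} q^(1/s) ‖qθ‖ > 0 (this condition being interpreted as vacuously true when s = 0). Then the set Bad(s,t;θ) = {y ∈ ℝ : inf_{q ∈ ℕ, q ≥ 1} max(q^s ‖qθ‖, q^t ‖qy‖) > 0} is 1/2-winning for Schmidt's game on ℝ; that is, for every β ∈ (0,1) there is a strategy f for Alice in the (1/2, β)-game such that for every play in which Alice follows f, the unique point of the intersection of the chosen intervals belongs to Bad(s,t;θ). -/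
/-- Distance from a real number to the nearest integer. -/
noncomputable def dInt (x : ℝ) : ℝ := ⨅ n : ℤ, |x - n|

/-- `Bad(s,t;θ)`: the set of `y` such that `(θ,y)` is `(s,t)`-badly approximable. -/
noncomputable def BadST (s t θ : ℝ) : Set ℝ :=
  {y : ℝ | 0 < ⨅ q : {q : ℕ // 0 < q},
      max ((q : ℝ) ^ s * dInt ((q : ℝ) * θ)) ((q : ℝ) ^ t * dInt ((q : ℝ) * y))}

noncomputable def phiG {ι : Type} (w : ι → ENNReal) (E : ι → Set ℝ) (T : Set ι) (a b : ℝ) : ENNReal :=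
  ∑' i, Set.indicator {i | i ∈ T ∧ (E i ∩ Set.Icc a b).Nonempty} w i

noncomputable def greedyG {ι : Type} (w : ι → ENNReal) (E : ι → Set ℝ) (T : Set ι) (I : ℝ × ℝ) : ℝ × ℝ :=
  open Classical in
  if phiG w E T I.1 ((I.1 + I.2) / 2) ≤ phiG w E T ((I.1 + I.2) / 2) I.2 then
    (I.1, (I.1 + I.2) / 2) else ((I.1 + I.2) / 2, I.2)

theorem tsum_ind_mono {ι : Type} (w : ι → ENNReal) {S T : Set ι} (h : S ⊆ T) :
    ∑' i, S.indicator w i ≤ ∑' i, T.indicator w i :=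
  ENNReal.tsum_le_tsum fun i => Set.indicator_le_indicator_of_subset h (fun _ => zero_le) i

theorem phiG_mono {ι : Type} (w : ι → ENNReal) (E : ι → Set ℝ) (T : Set ι) {a b a' b' : ℝ}
    (ha : a ≤ a') (hb : b' ≤ b) : phiG w E T a' b' ≤ phiG w E T a b := by
  apply tsum_ind_mono
  rintro i ⟨h1, x, h2, h3⟩
  exact ⟨h1, x, h2, Set.Icc_subset_Icc ha hb h3⟩

theorem phiG_greedy_le {ι : Type} (w : ι → ENNReal) (E : ι → Set ℝ) (T : Set ι) (I : ℝ × ℝ) :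
    phiG w E T (greedyG w E T I).1 (greedyG w E T I).2 ≤ phiG w E T I.1 ((I.1 + I.2) / 2) ∧
    phiG w E T (greedyG w E T I).1 (greedyG w E T I).2 ≤ phiG w E T ((I.1 + I.2) / 2) I.2 := by
  unfold greedyG
  split_ifs with h
  · exact ⟨le_rfl, h⟩
  · exact ⟨(not_le.mp h).le, le_rfl⟩

theorem tsum_diff_half {ι : Type} (w : ι → ENNReal) (hw : ∑' i, w i ≠ ⊤) (S T U : Set ι)
    (hST : ∑' i, S.indicator w i ≤ ∑' i, T.indicator w i) (hU : S ∪ T ⊆ U) :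
    2 * ∑' i, (S \ T).indicator w i ≤ ∑' i, U.indicator w i := by
  have add : ∀ P Q : Set ι, Disjoint P Q → ∑' i, (P ∪ Q).indicator w i
      = ∑' i, P.indicator w i + ∑' i, Q.indicator w i := by
    intro P Q h
    rw [← ENNReal.tsum_add]
    congr 1
    ext i
    rw [Set.indicator_union_of_disjoint h]
  have e1 := add (S \ T) (S ∩ T) (by
    rw [Set.disjoint_left]; rintro x ⟨_, h⟩ ⟨_, h'⟩; exact h h')
  have e2 := add (T \ S) (S ∩ T) (by
    rw [Set.disjoint_left]; rintro x ⟨_, h⟩ ⟨h', _⟩; exact h h')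
  rw [Set.sdiff_union_inter] at e1
  rw [Set.inter_comm, Set.sdiff_union_inter] at e2
  rw [Set.inter_comm T S] at e2
  have fin : ∑' i, (S ∩ T).indicator w i ≠ ⊤ := by
    refine ne_top_of_le_ne_top hw (ENNReal.tsum_le_tsum fun i => ?_)
    exact Set.indicator_le_self _ _ i
  rw [e1, e2] at hST
  have hle : ∑' i, (S \ T).indicator w i ≤ ∑' i, (T \ S).indicator w i :=
    (ENNReal.add_le_add_iff_right fin).mp hST
  have e3 := add (S \ T) (T \ S) (by
    rw [Set.disjoint_left]; rintro x ⟨_, h⟩ ⟨h', _⟩; exact h h')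
  calc 2 * ∑' i, (S \ T).indicator w i ≤ ∑' i, (S \ T ∪ T \ S).indicator w i := by
        rw [e3, two_mul]; gcongr
    _ ≤ _ := by
        apply tsum_ind_mono
        refine subset_trans ?_ hU
        rintro x (⟨h, _⟩ | ⟨h, _⟩)
        · exact Or.inl h
        · exact Or.inr h

theorem two_move {ι : Type} (w : ι → ENNReal) (hw : ∑' i, w i ≠ ⊤) (E : ι → Set ℝ) (T : Set ι)
    (β : ℝ) (I I' : ℝ × ℝ) (hI : I.1 < I.2)
    (tiny : ∀ i ∈ T, ∀ x ∈ E i, ∀ y ∈ E i, x ∈ Set.Icc I.1 I.2 → y ∈ Set.Icc I.1 I.2 →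
      |x - y| < β * (I.2 - I.1) / 4)
    (h1 : (greedyG w E T I).1 ≤ I'.1) (h2 : I'.2 ≤ (greedyG w E T I).2)
    (hlen : I'.2 - I'.1 = β * (I.2 - I.1) / 2) (hI' : I'.1 ≤ I'.2) :
    2 * phiG w E T (greedyG w E T I').1 (greedyG w E T I').2 ≤ phiG w E T I.1 I.2 := by
  obtain ⟨g1, g2⟩ := phiG_greedy_le w E T I'
  unfold greedyG at h1 h2
  split_ifs at h1 h2 with h
  · simp only at h1 h2
    refine le_trans (mul_le_mul_right g1 2) ?_
    refine le_trans ?_ (tsum_diff_half w hw _ _ {i | i ∈ T ∧ (E i ∩ Set.Icc I.1 I.2).Nonempty} h ?_)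
    · refine mul_le_mul_right (tsum_ind_mono w ?_) 2
      rintro i ⟨hT, x, hx, hx1, hx2⟩
      refine ⟨⟨hT, x, hx, by linarith, by linarith⟩, ?_⟩
      rintro ⟨_, y, hy, hy1, hy2⟩
      have := tiny i hT y hy x hx ⟨by linarith, by linarith⟩ ⟨by linarith, by linarith⟩
      have := (abs_lt.mp this).2
      linarith
    · rintro i (⟨hT, x, hx, hx1, hx2⟩ | ⟨hT, x, hx, hx1, hx2⟩)
      · exact ⟨hT, x, hx, hx1, by linarith⟩
      · exact ⟨hT, x, hx, by linarith, hx2⟩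
  · simp only at h1 h2
    refine le_trans (mul_le_mul_right g2 2) ?_
    refine le_trans ?_ (tsum_diff_half w hw _ _ {i | i ∈ T ∧ (E i ∩ Set.Icc I.1 I.2).Nonempty}
      (not_le.mp h).le ?_)
    · refine mul_le_mul_right (tsum_ind_mono w ?_) 2
      rintro i ⟨hT, x, hx, hx1, hx2⟩
      refine ⟨⟨hT, x, hx, by linarith, by linarith⟩, ?_⟩
      rintro ⟨_, y, hy, hy1, hy2⟩
      have := tiny i hT x hx y hy ⟨by linarith, by linarith⟩ ⟨by linarith, by linarith⟩
      have := (abs_lt.mp this).2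
      linarith
    · rintro i (⟨hT, x, hx, hx1, hx2⟩ | ⟨hT, x, hx, hx1, hx2⟩)
      · exact ⟨hT, x, hx, by linarith, hx2⟩
      · exact ⟨hT, x, hx, hx1, by linarith⟩

noncomputable def wG (i : ℕ × ℕ) : ENNReal := (2⁻¹ : ENNReal) ^ (i.1 + i.2)

theorem wG_row (m : ℕ) : ∑' k, wG (m, k) = (2⁻¹ : ENNReal) ^ m * 2 := by
  unfold wG
  simp only [pow_add]
  rw [ENNReal.tsum_mul_left, ENNReal.tsum_geometric]
  congr 1
  rw [ENNReal.one_sub_inv_two, inv_inv]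

theorem wG_fin : ∑' i, wG i ≠ ⊤ := by
  rw [ENNReal.tsum_prod']
  simp only [wG_row]
  rw [ENNReal.tsum_mul_right, ENNReal.tsum_geometric, ENNReal.one_sub_inv_two, inv_inv]
  exact ENNReal.mul_ne_top (by simp) (by simp)

theorem wG_ind_row (m : ℕ) :
    ∑' i, Set.indicator {i : ℕ × ℕ | i.1 = m} wG i = (2⁻¹ : ENNReal) ^ m * 2 := by
  rw [ENNReal.tsum_prod', tsum_eq_single m]
  · rw [← wG_row]
    congr 1
    ext k
    simp
  · intro b hb
    simp [hb]

theorem phiG_step (E : ℕ × ℕ → Set ℝ) (m : ℕ) (a b : ℝ) :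
    phiG wG E {i | i.1 ≤ m + 1} a b ≤ phiG wG E {i | i.1 ≤ m} a b + (2⁻¹ : ENNReal) ^ (m+1) * 2 := by
  rw [← wG_ind_row (m+1)]
  unfold phiG
  rw [← ENNReal.tsum_add]
  refine ENNReal.tsum_le_tsum fun i => ?_
  by_cases h : i.1 = m + 1
  · refine le_trans ?_ le_add_self
    rw [Set.indicator_of_mem (s := {i : ℕ × ℕ | i.1 = m + 1}) h]
    exact Set.indicator_le_self _ _ i
  · refine le_trans ?_ le_self_add
    by_cases h2 : i ∈ {i : ℕ × ℕ | i ∈ {i : ℕ × ℕ | i.1 ≤ m + 1} ∧ (E i ∩ Set.Icc a b).Nonempty}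
    · have : i ∈ {i : ℕ × ℕ | i ∈ {i : ℕ × ℕ | i.1 ≤ m} ∧ (E i ∩ Set.Icc a b).Nonempty} := by
        refine ⟨?_, h2.2⟩
        have := h2.1
        simp only [Set.mem_ofPred_eq] at this ⊢
        omega
      rw [Set.indicator_of_mem h2, Set.indicator_of_mem this]
    · rw [Set.indicator_of_notMem h2]; exact zero_le

theorem greedy_legal {ι : Type} (w : ι → ENNReal) (E : ι → Set ℝ) (T : Set ι) (I : ℝ × ℝ)
    (h : I.1 ≤ I.2) : I.1 ≤ (greedyG w E T I).1 ∧ (greedyG w E T I).2 ≤ I.2 ∧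
      (greedyG w E T I).2 - (greedyG w E T I).1 = 1 / 2 * (I.2 - I.1) := by
  unfold greedyG
  split_ifs <;> refine ⟨?_, ?_, ?_⟩ <;> simp only <;> linarith

theorem game_main (β : ℝ) (hβ : 0 < β) (hβ1 : β < 1) (L : ℝ) (hL : 0 < L) (E : ℕ × ℕ → Set ℝ)
    (tiny : ∀ (m : ℕ) (a b : ℝ), b - a = L * (β/2)^(6*m) →
      (∀ i : ℕ × ℕ, i.1 + i.2 < m → ∀ x ∈ E i, x ∉ Set.Icc a b) →
      ∀ k : ℕ, ∀ x ∈ E (m, k), ∀ y ∈ E (m, k), x ∈ Set.Icc a b → y ∈ Set.Icc a b →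
        |x - y| < β / 4 * (L * (β/2)^(6*(m+k+1))))
    (B A : ℕ → ℝ × ℝ)
    (hA : ∀ n, A n = greedyG wG E {i | i.1 ≤ n / 6} (B n))
    (hB0 : (B 0).2 - (B 0).1 = L)
    (hB : ∀ n : ℕ, Set.Icc (B (n + 1)).1 (B (n + 1)).2 ⊆ Set.Icc (A n).1 (A n).2 ∧
            (B (n + 1)).2 - (B (n + 1)).1 = β * ((A n).2 - (A n).1)) :
    (∀ n : ℕ, Set.Icc (A n).1 (A n).2 ⊆ Set.Icc (B n).1 (B n).2 ∧
            (A n).2 - (A n).1 = (1 / 2) * ((B n).2 - (B n).1)) ∧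
    ∀ x : ℝ, (∀ n : ℕ, x ∈ Set.Icc (A n).1 (A n).2) → ∀ i, x ∉ E i := by
  have hlen : ∀ n, (B n).2 - (B n).1 = L * (β/2)^n := by
    intro n
    induction n with
    | zero => simpa using hB0
    | succ n ih =>
      have hpos : 0 < L * (β/2)^n := by positivity
      have := (greedy_legal wG E {i | i.1 ≤ n / 6} (B n) (by linarith)).2.2
      rw [(hB n).2, hA n, this, ih]; ring
  have hlt : ∀ n, (B n).1 < (B n).2 := by
    intro n
    have := hlen n
    have hpos : 0 < L * (β/2)^n := by positivity
    linarith
  have hleg : ∀ n, (B n).1 ≤ (A n).1 ∧ (A n).2 ≤ (B n).2 ∧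
      (A n).2 - (A n).1 = 1 / 2 * ((B n).2 - (B n).1) := by
    intro n
    rw [hA n]; exact greedy_legal _ _ _ _ (hlt n).le
  have hsub : ∀ n, (A n).1 ≤ (B (n+1)).1 ∧ (B (n+1)).2 ≤ (A n).2 := fun n =>
    (Set.Icc_subset_Icc_iff (hlt (n+1)).le).mp (hB n).1
  have hanti : ∀ n d, (B n).1 ≤ (B (n+d)).1 ∧ (B (n+d)).2 ≤ (B n).2 := by
    intro n d
    induction d with
    | zero => exact ⟨le_rfl, le_rfl⟩
    | succ d ih =>
      have h1 := hsub (n+d)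
      have h2 := hleg (n+d)
      rw [← add_assoc]
      constructor <;> linarith [h1.1, h1.2, h2.1, h2.2.1, ih.1, ih.2]
  refine ⟨fun n => ⟨Set.Icc_subset_Icc (hleg n).1 (hleg n).2.1, (hleg n).2.2⟩, ?_⟩
  have inv : ∀ m : ℕ,
      (∀ i : ℕ × ℕ, i.1 + i.2 < m → ∀ x ∈ E i, x ∉ Set.Icc (B (6*m)).1 (B (6*m)).2) ∧
      phiG wG E {i | i.1 ≤ m} (B (6*m)).1 (B (6*m)).2 ≤ 4 * (2⁻¹ : ENNReal)^m ∧
      (∀ i : ℕ × ℕ, i.1 < m → ∀ x ∈ E i, ∀ y ∈ E i, x ∈ Set.Icc (B (6*m)).1 (B (6*m)).2 →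
        y ∈ Set.Icc (B (6*m)).1 (B (6*m)).2 → |x - y| < β / 4 * (L * (β/2)^(6*(i.1+i.2+1)))) := by
    intro m
    induction m with
    | zero =>
      refine ⟨fun i hi => by omega, ?_, fun i hi => by omega⟩
      calc phiG wG E {i | i.1 ≤ 0} (B (6*0)).1 (B (6*0)).2
          ≤ ∑' i, Set.indicator {i : ℕ × ℕ | i.1 = 0} wG i := by
            apply tsum_ind_mono
            rintro i ⟨h, _⟩
            exact Nat.le_zero.mp h
        _ = 2 := by rw [wG_ind_row]; simp
        _ ≤ _ := by simp; norm_num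
    | succ m ih =>
      obtain ⟨dead, hphi, htiny⟩ := ih
      have htiny' : ∀ i : ℕ × ℕ, i.1 ≤ m → ∀ x ∈ E i, ∀ y ∈ E i,
          x ∈ Set.Icc (B (6*m)).1 (B (6*m)).2 → y ∈ Set.Icc (B (6*m)).1 (B (6*m)).2 →
          |x - y| < β / 4 * (L * (β/2)^(6*(i.1+i.2+1))) := by
        rintro ⟨i, k⟩ hi
        rcases Nat.lt_or_eq_of_le hi with h | h
        · exact htiny _ h
        · simp only at h
          subst h
          exact tiny i _ _ (hlen _) dead k
      have step : ∀ j, j < 5 →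
          2 * phiG wG E {i | i.1 ≤ m} (B (6*m+j+2)).1 (B (6*m+j+2)).2 ≤
            phiG wG E {i | i.1 ≤ m} (B (6*m+j)).1 (B (6*m+j)).2 := by
        intro j hj
        have e1 : (6*m+j)/6 = m := by omega
        have e2 : (6*m+j+1)/6 = m := by omega
        have a1 := hA (6*m+j)
        have a2 := hA (6*m+j+1)
        rw [e1] at a1
        rw [e2] at a2
        have key := two_move wG wG_fin E {i | i.1 ≤ m} β (B (6*m+j)) (B (6*m+j+1)) (hlt _) ?_
          (by rw [← a1]; exact (hsub _).1) (by rw [← a1]; exact (hsub _).2)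
          (by rw [(hB _).2, (hleg _).2.2]; ring) (hlt _).le
        · rw [← a2] at key
          refine le_trans (mul_le_mul_right ?_ 2) key
          exact phiG_mono _ _ _ (hsub _).1 (hsub _).2
        · intro i hi x hx y hy hxI hyI
          have s1 := hanti (6*m) j
          have hsubI := Set.Icc_subset_Icc s1.1 s1.2
          by_cases hd : i.1 + i.2 < m
          · exact absurd (hsubI hxI) (dead i hd x hx)
          · have := htiny' i hi x hx y hy (hsubI hxI) (hsubI hyI)
            refine lt_of_lt_of_le this ?_
            rw [hlen]
            have hp : (β/2)^(6*(i.1+i.2+1)) ≤ (β/2)^(6*m+j) :=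
              pow_le_pow_of_le_one (by positivity) (by linarith) (by omega)
            have : β / 4 * (L * (β/2)^(6*(i.1+i.2+1))) ≤ β / 4 * (L * (β/2)^(6*m+j)) := by gcongr
            linarith
      have h8 : 8 * phiG wG E {i | i.1 ≤ m} (B (6*(m+1))).1 (B (6*(m+1))).2 ≤ 4 * (2⁻¹ : ENNReal)^m := by
        have s0 := step 0 (by norm_num)
        have s2 := step 2 (by norm_num)
        have s4 := step 4 (by norm_num)
        have e : 6*(m+1) = 6*m+4+2 := by ring
        rw [e]
        calc 8 * phiG wG E {i | i.1 ≤ m} (B (6*m+4+2)).1 (B (6*m+4+2)).2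
            = 2 * (2 * (2 * phiG wG E {i | i.1 ≤ m} (B (6*m+4+2)).1 (B (6*m+4+2)).2)) := by ring
          _ ≤ 2 * (2 * phiG wG E {i | i.1 ≤ m} (B (6*m+4)).1 (B (6*m+4)).2) := by gcongr
          _ ≤ 2 * phiG wG E {i | i.1 ≤ m} (B (6*m+2)).1 (B (6*m+2)).2 := by gcongr
          _ ≤ _ := s0
          _ ≤ _ := hphi
      have h2 : 2 * phiG wG E {i | i.1 ≤ m} (B (6*(m+1))).1 (B (6*(m+1))).2 ≤ (2⁻¹ : ENNReal)^m := by
        have : (4 : ENNReal) * (2 * phiG wG E {i | i.1 ≤ m} (B (6*(m+1))).1 (B (6*(m+1))).2)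
            ≤ 4 * (2⁻¹ : ENNReal)^m := by
          rw [← mul_assoc]; norm_num; exact h8
        exact (ENNReal.mul_le_mul_iff_right (by norm_num) (by norm_num)).mp this
      have s1 := hanti (6*m) 6
      have hsubI := Set.Icc_subset_Icc s1.1 s1.2
      refine ⟨?_, ?_, ?_⟩
      · intro i hi x hx hxI
        have hle : wG i ≤ phiG wG E {i | i.1 ≤ m} (B (6*(m+1))).1 (B (6*(m+1))).2 := by
          have hmem : i ∈ {i : ℕ × ℕ | i ∈ {i : ℕ × ℕ | i.1 ≤ m} ∧
              (E i ∩ Set.Icc (B (6*(m+1))).1 (B (6*(m+1))).2).Nonempty} :=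
            ⟨by simp only [Set.mem_ofPred_eq]; omega, x, hx, hxI⟩
          rw [← Set.indicator_of_mem hmem wG]
          exact ENNReal.le_tsum i
        have hw : (2⁻¹ : ENNReal)^m ≤ wG i := by
          unfold wG
          exact pow_le_pow_of_le_one zero_le (by simp) (by omega)
        have h3 : 2 * (2⁻¹ : ENNReal)^m ≤ (2⁻¹ : ENNReal)^m :=
          le_trans (by gcongr; exact hw.trans hle) h2
        have hfin : (2⁻¹ : ENNReal)^m ≠ ⊤ := ENNReal.pow_ne_top (by simp)
        have hne : (2⁻¹ : ENNReal)^m ≠ 0 := pow_ne_zero _ (by simp)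
        rw [two_mul] at h3
        have := ENNReal.lt_add_right hfin hne
        exact absurd h3 (not_le.mpr this)
      · refine le_trans (phiG_step E m _ _) ?_
        have h3 : phiG wG E {i | i.1 ≤ m} (B (6*(m+1))).1 (B (6*(m+1))).2 ≤ (2⁻¹ : ENNReal)^(m+1) := by
          have := mul_le_mul_right h2 (2⁻¹ : ENNReal)
          rw [← mul_assoc, ENNReal.inv_mul_cancel (by simp) (by simp), one_mul] at this
          rw [pow_succ, mul_comm ((2⁻¹ : ENNReal) ^ m)]
          exact this
        calc _ ≤ (2⁻¹ : ENNReal)^(m+1) + (2⁻¹ : ENNReal)^(m+1) * 2 := by gcongr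
          _ = 3 * (2⁻¹ : ENNReal)^(m+1) := by ring
          _ ≤ _ := by gcongr; norm_num
      · intro i hi x hx y hy hxI hyI
        exact htiny' i (by omega) x hx y hy (hsubI hxI) (hsubI hyI)
  intro x hx i hxi
  refine (inv (i.1 + i.2 + 1)).1 i (by omega) x hxi ?_
  exact Set.Icc_subset_Icc (hleg _).1 (hleg _).2.1 (hx _)
theorem dInt_bdd (x : ℝ) : BddBelow (Set.range fun n : ℤ => |x - n|) :=
  ⟨0, by rintro _ ⟨n, rfl⟩; exact abs_nonneg _⟩

theorem dInt_nonneg (x : ℝ) : 0 ≤ dInt x := Real.iInf_nonneg fun _ => abs_nonneg _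

theorem pigeon (a b : ℕ) (q : ℤ) (hq : 0 < q) (hab : q < ((a+1) * (b+1) : ℕ)) (p r : ℤ) :
    ∃ A B C : ℤ, (A ≠ 0 ∨ B ≠ 0) ∧ |A| ≤ a ∧ |B| ≤ b ∧ A * p + B * r + C * q = 0 := by
  have : ∃ x ∈ Finset.range (a+1) ×ˢ Finset.range (b+1),
      ∃ y ∈ Finset.range (a+1) ×ˢ Finset.range (b+1), x ≠ y ∧
      ((x.1:ℤ) * p + x.2 * r) % q = ((y.1:ℤ) * p + y.2 * r) % q := by
    apply Finset.exists_ne_map_eq_of_card_lt_of_maps_to (t := Finset.Ico 0 q)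
    · simp only [Int.card_Ico, Finset.card_product, Finset.card_range]
      omega
    · intro x _
      simp only [Finset.coe_Ico, Set.mem_Ico]
      exact ⟨Int.emod_nonneg _ hq.ne', Int.emod_lt_of_pos _ hq⟩
  obtain ⟨x, hx, y, hy, hne, he⟩ := this
  simp only [Finset.mem_product, Finset.mem_range] at hx hy
  obtain ⟨C, hC⟩ := (Int.ModEq.dvd he : q ∣ _)
  refine ⟨(x.1:ℤ) - y.1, (x.2:ℤ) - y.2, C, ?_, ?_, ?_, ?_⟩
  · by_contra hcon
    push Not at hcon
    exact hne (Prod.ext (by omega) (by omega))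
  · rw [abs_le]; omega
  · rw [abs_le]; omega
  · linear_combination -hC

theorem lines_exist (s t θ : ℝ) (hs : 0 ≤ s) (ht : 0 ≤ t) (hst : s + t = 1)
    (hθ : s ≠ 0 → 0 < ⨅ q : {q : ℕ // 0 < q}, (q : ℝ) ^ (1 / s) * dInt ((q : ℝ) * θ)) :
    ∃ c0 : ℝ, 0 < c0 ∧ ∀ q p r : ℤ, 0 < q → (q:ℝ)^s * |(q:ℝ) * θ - p| < c0 →
      ∃ A B C : ℤ, B ≠ 0 ∧ (|A| : ℝ) ≤ (q:ℝ)^s ∧ (|B| : ℝ) ≤ (q:ℝ)^t ∧ A * p + B * r + C * q = 0 := by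
  rcases eq_or_ne s 0 with h0 | h0
  · subst h0
    have ht1 : t = 1 := by linarith
    subst ht1
    refine ⟨1, one_pos, fun q p r hq _ => ⟨0, q, -r, hq.ne', by simp, ?_, by ring⟩⟩
    have : (0:ℝ) < q := by exact_mod_cast hq
    rw [Real.rpow_one, abs_of_pos this]
  · have hs' : 0 < s := lt_of_le_of_ne hs h0.symm
    have hc := hθ h0
    set c0 := ⨅ q : {q : ℕ // 0 < q}, (q : ℝ) ^ (1 / s) * dInt ((q : ℝ) * θ) with hc0
    have hle : ∀ q : ℕ, 0 < q → c0 ≤ (q:ℝ)^(1/s) * dInt ((q:ℝ) * θ) := by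
      intro q hq
      refine ciInf_le (f := fun q : {q : ℕ // 0 < q} => ((q:ℕ) : ℝ) ^ (1 / s) * dInt (((q:ℕ) : ℝ) * θ)) ?_ ⟨q, hq⟩
      refine ⟨0, ?_⟩
      rintro _ ⟨n, rfl⟩
      exact mul_nonneg (by positivity) (dInt_nonneg _)
    refine ⟨c0, hc, fun q p r hq hlt => ?_⟩
    have hqr : (0:ℝ) < q := by exact_mod_cast hq
    have f1 : (0:ℝ) ≤ (q:ℝ)^s := by positivity
    have f2 : (0:ℝ) ≤ (q:ℝ)^t := by positivity
    obtain ⟨A, B, C, hne, hA, hB, hL⟩ := pigeon ⌊(q:ℝ)^s⌋₊ ⌊(q:ℝ)^t⌋₊ q hq (by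
      have g1 := Nat.lt_floor_add_one ((q:ℝ)^s)
      have g2 := Nat.lt_floor_add_one ((q:ℝ)^t)
      have : (q:ℝ) < ((⌊(q:ℝ)^s⌋₊ + 1) * (⌊(q:ℝ)^t⌋₊ + 1) : ℝ) := by
        calc (q:ℝ) = (q:ℝ)^s * (q:ℝ)^t := by rw [← Real.rpow_add hqr, hst, Real.rpow_one]
          _ < _ := by gcongr
      exact_mod_cast this) p r
    have hA' : |(A:ℝ)| ≤ (q:ℝ)^s := by
      have : |(A:ℝ)| ≤ (⌊(q:ℝ)^s⌋₊ : ℝ) := by exact_mod_cast hA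
      exact this.trans (Nat.floor_le f1)
    have hB' : |(B:ℝ)| ≤ (q:ℝ)^t := by
      have : |(B:ℝ)| ≤ (⌊(q:ℝ)^t⌋₊ : ℝ) := by exact_mod_cast hB
      exact this.trans (Nat.floor_le f2)
    refine ⟨A, B, C, ?_, hA', hB', hL⟩
    rintro rfl
    have hA0 : A ≠ 0 := by simpa using hne
    have hLr : (A:ℝ) * p + C * q = 0 := by
      have : A * p + C * q = 0 := by linarith
      exact_mod_cast this
    have h1 := hle A.natAbs (Int.natAbs_pos.mpr hA0)
    have hAn : ((A.natAbs : ℕ) : ℝ) = |(A:ℝ)| := by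
      rw [Nat.cast_natAbs]; push_cast; rfl
    rw [hAn] at h1
    have h2 : dInt (|(A:ℝ)| * θ) ≤ |A * θ + C| := by
      rcases abs_choice (A:ℝ) with h | h
      · rw [h]
        refine (ciInf_le (dInt_bdd _) (-C)).trans ?_
        push_cast; rw [sub_neg_eq_add]
      · rw [h]
        refine (ciInf_le (dInt_bdd _) C).trans ?_
        rw [← abs_neg]
        apply le_of_eq; congr 1; ring
    have h3 : |(A:ℝ)|^(1/s) ≤ q := by
      calc |(A:ℝ)|^(1/s) ≤ ((q:ℝ)^s)^(1/s) := Real.rpow_le_rpow (abs_nonneg _) hA' (by positivity)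
        _ = q := by rw [← Real.rpow_mul hqr.le, mul_one_div_cancel h0, Real.rpow_one]
    have h4 : q * |(A:ℝ) * θ + C| = |(A:ℝ)| * |q * θ - p| := by
      rw [← abs_mul]
      nth_rewrite 1 [← abs_of_pos hqr]
      rw [← abs_mul]
      congr 1
      linear_combination hLr
    have h5 : |(A:ℝ)| * |q * θ - p| ≤ (q:ℝ)^s * |q * θ - p| := by gcongr
    have h6 : |(A:ℝ)|^(1/s) * dInt (|(A:ℝ)| * θ) ≤ q * |A * θ + C| :=
      mul_le_mul h3 h2 (dInt_nonneg _) hqr.le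
    linarith

structure PtG (s t θ c y : ℝ) (q p r A B C : ℤ) : Prop where
  hq : 0 < q
  h1 : (q:ℝ)^s * |(q:ℝ) * θ - p| < c
  h2 : (q:ℝ)^t * |(q:ℝ) * y - r| < c
  hB : B ≠ 0
  hA : (|A| : ℝ) ≤ (q:ℝ)^s
  hBt : (|B| : ℝ) ≤ (q:ℝ)^t
  hL : A * p + B * r + C * q = 0

noncomputable def yL (θ : ℝ) (A B C : ℤ) : ℝ := -(A * θ + C) / B

theorem yL_eq {θ : ℝ} {A B C : ℤ} (hB : B ≠ 0) : (A:ℝ) * θ + B * yL θ A B C + C = 0 := by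
  have : (B:ℝ) ≠ 0 := by exact_mod_cast hB
  unfold yL
  field_simp
  ring

theorem PtG.near {s t θ c y : ℝ} {q p r A B C : ℤ} (P : PtG s t θ c y q p r A B C) :
    (q:ℝ) * |(B:ℝ)| * |yL θ A B C - y| ≤ 2 * c := by
  have hq : (0:ℝ) < q := by exact_mod_cast P.hq
  have e := yL_eq (θ := θ) (A := A) (C := C) P.hB
  have hL : (A:ℝ) * p + B * r + C * q = 0 := by exact_mod_cast P.hL
  have : (q:ℝ) * B * (yL θ A B C - y) = -(B * (q * y - r)) - A * (q * θ - p) := by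
    linear_combination q * e - hL
  have h3 : |(q:ℝ) * B * (yL θ A B C - y)| ≤ |(B:ℝ)| * |q * y - r| + |(A:ℝ)| * |q * θ - p| := by
    rw [this, ← abs_mul, ← abs_mul]
    refine (abs_sub _ _).trans ?_
    rw [abs_neg]
  rw [abs_mul, abs_mul, abs_of_pos hq] at h3
  have h4 : |(B:ℝ)| * |q * y - r| ≤ c :=
    (mul_le_mul_of_nonneg_right P.hBt (abs_nonneg _)).trans P.h2.le
  have h5 : |(A:ℝ)| * |q * θ - p| ≤ c :=
    (mul_le_mul_of_nonneg_right P.hA (abs_nonneg _)).trans P.h1.le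
  linarith

theorem PtG.near' {s t θ c y H : ℝ} {q p r A B C : ℤ} (P : PtG s t θ c y q p r A B C)
    (hH : 0 < H) (hle : H ≤ (q:ℝ) * |(B:ℝ)|) : |yL θ A B C - y| ≤ 2 * c / H := by
  rw [le_div_iff₀ hH]
  have := mul_le_mul_of_nonneg_right hle (abs_nonneg (yL θ A B C - y))
  linarith [P.near]

/-- the intersection point of two lines -/
theorem cross_theta {θ : ℝ} {A B C A' B' C' : ℤ} (hB : B ≠ 0) (hB' : B' ≠ 0) :
    (B:ℝ) * B' * (yL θ A B C - yL θ A' B' C') =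
      ((B * C' - B' * C : ℤ) : ℝ) - ((A * B' - A' * B : ℤ) : ℝ) * θ := by
  have e := yL_eq (θ := θ) (A := A) (C := C) hB
  have e' := yL_eq (θ := θ) (A := A') (C := C') hB'
  push_cast
  linear_combination B' * e - B * e'

theorem cross_y {θ : ℝ} {A B C A' B' C' : ℤ} (hB : B ≠ 0) (hB' : B' ≠ 0) :
    ((A * B' - A' * B : ℤ) : ℝ) * yL θ A B C - ((C * A' - A * C' : ℤ) : ℝ) =
      (A:ℝ) * B' * (yL θ A B C - yL θ A' B' C') := by
  have e := yL_eq (θ := θ) (A := A) (C := C) hB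
  have e' := yL_eq (θ := θ) (A := A') (C := C') hB'
  push_cast
  linear_combination  A * e' - A' * e

theorem tiny_zero {s t θ c y y' H M ρ R : ℝ} {q p r A B C q' p' r' A' B' C' : ℤ}
    (hs : 0 ≤ s) (ht : 0 ≤ t) (hst : s + t = 1) (hH : 0 < H) (hM : 1 ≤ M) (hR : 1 ≤ R)
    (hc : 0 < c) (hcρ : c ≤ ρ) (hsmall : 5 * ρ * R * M < 1)
    (P : PtG s t θ c y q p r A B C) (P' : PtG s t θ c y' q' p' r' A' B' C')
    (hl : H ≤ (q:ℝ) * |(B:ℝ)|) (hu : (q:ℝ) * |(B:ℝ)| < R * H) (hq : (q:ℝ)^(1+t) < H * M)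
    (hl' : H ≤ (q':ℝ) * |(B':ℝ)|) (hu' : (q':ℝ) * |(B':ℝ)| < R * H) (hq' : (q':ℝ)^(1+t) < H * M)
    (hy : |y - y'| ≤ ρ / H) : |y - y'| ≤ 4 * c / H := by
  -- vanishing
  have van : ∀ {y y' : ℝ} {q p r A B C q' p' r' A' B' C' : ℤ},
    PtG s t θ c y q p r A B C → PtG s t θ c y' q' p' r' A' B' C' →
    H ≤ (q:ℝ) * |(B:ℝ)| → (q:ℝ) * |(B:ℝ)| < R * H → (q:ℝ)^(1+t) < H * M →
    H ≤ (q':ℝ) * |(B':ℝ)| → (q':ℝ) * |(B':ℝ)| < R * H → (q':ℝ)^(1+t) < H * M →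
    |y - y'| ≤ ρ / H → A * p' + B * r' + C * q' = 0 := by
    intro y y' q p r A B C q' p' r' A' B' C' P P' hl hu hq hl' hu' hq' hy
    have hqp : (0:ℝ) < q := by exact_mod_cast P.hq
    have hqp' : (0:ℝ) < q' := by exact_mod_cast P'.hq
    have ratio : ∀ {u v : ℝ} {b : ℝ}, 0 < u → 0 < v → v^(1+t) < H * M → H ≤ u * b → b ≤ u^t →
        v ≤ u * M := by
      intro u v b hu hv h1 h2 h3
      have h4 : H ≤ u^(1+t) := by
        rw [Real.rpow_add hu, Real.rpow_one]
        exact h2.trans (by gcongr)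
      by_contra hcon
      push Not at hcon
      have h5 : (u*M)^(1+t) ≤ v^(1+t) :=
        Real.rpow_le_rpow (by positivity) hcon.le (by linarith)
      rw [Real.mul_rpow hu.le (by linarith)] at h5
      have h6 : M ≤ M^(1+t) := by
        conv_lhs => rw [← Real.rpow_one M]
        exact Real.rpow_le_rpow_of_exponent_le hM (by linarith)
      have : H * M ≤ u^(1+t) * M^(1+t) := by gcongr
      linarith
    have r1 := ratio hqp hqp' hq' hl P.hBt
    have r2 := ratio hqp' hqp hq hl' P'.hBt
    have e := yL_eq (θ := θ) (A := A) (C := C) P.hB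
    have eq : (A:ℝ) * p' + B * r' + C * q' =
        -(A * (q' * θ - p')) - B * (q' * (yL θ A B C - y)) - B * (q' * (y - y')) - B * (q' * y' - r') := by
      linear_combination q' * e
    have b1 : |(A:ℝ)| * |q' * θ - p'| ≤ M * c := by
      have : |(A:ℝ)| ≤ M * (q':ℝ)^s := by
        refine P.hA.trans ?_
        calc (q:ℝ)^s ≤ (q' * M)^s := Real.rpow_le_rpow hqp.le r2 hs
          _ = q'^s * M^s := Real.mul_rpow hqp'.le (by linarith)
          _ ≤ q'^s * M^(1:ℝ) := by gcongr; linarith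
          _ = _ := by rw [Real.rpow_one]; ring
      calc _ ≤ M * (q':ℝ)^s * |q' * θ - p'| := by gcongr
        _ = M * ((q':ℝ)^s * |q' * θ - p'|) := by ring
        _ ≤ _ := by have := P'.h1.le; gcongr
    have hBq : |(B:ℝ)| * q' ≤ M * R * H := by
      calc |(B:ℝ)| * q' ≤ |(B:ℝ)| * (q * M) := by gcongr
        _ = M * (q * |(B:ℝ)|) := by ring
        _ ≤ M * (R * H) := by gcongr
        _ = _ := by ring
    have b2 : |(B:ℝ)| * (q' * |yL θ A B C - y|) ≤ 2 * c * (M * R) := by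
      calc _ = |(B:ℝ)| * q' * |yL θ A B C - y| := by ring
        _ ≤ M * R * H * (2 * c / H) := by
          have := P.near' hH hl
          gcongr
        _ = _ := by field_simp
    have b3 : |(B:ℝ)| * (q' * |y - y'|) ≤ ρ * (M * R) := by
      calc _ = |(B:ℝ)| * q' * |y - y'| := by ring
        _ ≤ M * R * H * (ρ / H) := by gcongr
        _ = _ := by field_simp
    have b4 : |(B:ℝ)| * |q' * y' - r'| ≤ M * c := by
      have : |(B:ℝ)| ≤ M * (q':ℝ)^t := by
        refine P.hBt.trans ?_
        calc (q:ℝ)^t ≤ (q' * M)^t := Real.rpow_le_rpow hqp.le r2 ht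
          _ = q'^t * M^t := Real.mul_rpow hqp'.le (by linarith)
          _ ≤ q'^t * M^(1:ℝ) := by gcongr; linarith
          _ = _ := by rw [Real.rpow_one]; ring
      calc _ ≤ M * (q':ℝ)^t * |q' * y' - r'| := by gcongr
        _ = M * ((q':ℝ)^t * |q' * y' - r'|) := by ring
        _ ≤ _ := by have := P'.h2.le; gcongr
    have tot : |(A:ℝ) * p' + B * r' + C * q'| < 1 := by
      rw [eq]
      have t1 := abs_sub (-(A * (q' * θ - p')) - B * (q' * (yL θ A B C - y)) - B * (q' * (y - y')))
        (B * (q' * y' - r') : ℝ)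
      have t2 := abs_sub (-(A * (q' * θ - p')) - B * (q' * (yL θ A B C - y)) : ℝ) (B * (q' * (y - y')))
      have t3 := abs_sub (-(A * (q' * θ - p')) : ℝ) (B * (q' * (yL θ A B C - y)))
      rw [abs_neg] at t3
      simp only [abs_mul, abs_of_pos hqp'] at t1 t2 t3
      have : M * c ≤ ρ * (M * R) := by
        have : M * 1 * c ≤ M * R * ρ := by gcongr
        linarith
      have : c * (M * R) ≤ ρ * (M * R) := by gcongr
      have : 5 * (ρ * (M * R)) < 1 := by linarith
      linarith
    have tot' : |A * p' + B * r' + C * q'| < 1 := by exact_mod_cast tot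
    exact Int.abs_lt_one_iff.mp tot'
  have v1 := van P P' hl hu hq hl' hu' hq' hy
  have v2 := van P' P hl' hu' hq' hl hu hq (by rw [abs_sub_comm]; exact hy)
  have n1 := P.near' hH hl
  have n2 := P'.near' hH hl'
  have hqp : (0:ℝ) < q := by exact_mod_cast P.hq
  have hqp' : (0:ℝ) < q' := by exact_mod_cast P'.hq
  by_cases hu0 : p * q' - p' * q = 0
  · have hv0 : r * q' - r' * q = 0 := by
      have : B * (r * q' - r' * q) = 0 := by
        linear_combination q' * P.hL - q * v1 - A * hu0
      exact (mul_eq_zero.mp this).resolve_left P.hB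
    have hv : (r:ℝ) * q' - r' * q = 0 := by exact_mod_cast hv0
    have near : ∀ {y : ℝ} {q p r A B C : ℤ}, PtG s t θ c y q p r A B C → H ≤ (q:ℝ) * |(B:ℝ)| →
        |y - r / q| ≤ c / H := by
      intro y q p r A B C P hl
      have hqp : (0:ℝ) < q := by exact_mod_cast P.hq
      have e : y - r / q = (q * y - r) / q := by field_simp
      rw [e, abs_div, abs_of_pos hqp, div_le_div_iff₀ hqp hH]
      calc |(q:ℝ) * y - r| * H ≤ |(q:ℝ) * y - r| * (q * |(B:ℝ)|) := by gcongr
        _ ≤ |(q:ℝ) * y - r| * (q * (q:ℝ)^t) := by have := P.hBt; gcongr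
        _ = q * ((q:ℝ)^t * |(q:ℝ) * y - r|) := by ring
        _ ≤ q * c := by have := P.h2.le; gcongr
        _ = _ := by ring
    have m1 := near P hl
    have m2 := near P' hl'
    have e : (r:ℝ) / q = r' / q' := by
      rw [div_eq_div_iff hqp.ne' hqp'.ne']; linarith
    rw [e] at m1
    have := abs_sub_le y (r'/q') y'
    rw [abs_sub_comm (r'/q' : ℝ)] at this
    have : 0 < c / H := by positivity
    have : 4 * c / H = 4 * (c / H) := by ring
    linarith
  · have hD : A * B' - A' * B = 0 := by
      have : (A * B' - A' * B) * (p * q' - p' * q) = 0 := by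
        linear_combination B' * q' * P.hL - B' * q * v1 - B * q' * v2 + B * q * P'.hL
      exact (mul_eq_zero.mp this).resolve_right hu0
    have hp : B * C' - B' * C = 0 := by
      have : (B * C' - B' * C) * q = 0 := by
        linear_combination B * v2 - B' * P.hL + p * hD
      exact (mul_eq_zero.mp this).resolve_right P.hq.ne'
    have e := cross_theta (θ := θ) (A := A) (C := C) (A' := A') (C' := C') P.hB P'.hB
    rw [hD, hp] at e
    have hB : (B:ℝ) ≠ 0 := by exact_mod_cast P.hB
    have hB' : (B':ℝ) ≠ 0 := by exact_mod_cast P'.hB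
    have e2 : yL θ A B C - yL θ A' B' C' = 0 := by
      have : (B:ℝ) * B' * (yL θ A B C - yL θ A' B' C') = 0 := by rw [e]; simp
      exact (mul_eq_zero.mp this).resolve_left (mul_ne_zero hB hB')
    have e3 : yL θ A B C = yL θ A' B' C' := by linarith
    rw [e3] at n1
    have := abs_sub_le y (yL θ A' B' C') y'
    rw [abs_sub_comm y (yL θ A' B' C')] at this
    have : 4 * c / H = 2 * c / H + 2 * c / H := by ring
    linarith

theorem safe_signed {s t θ c y T : ℝ}
    (safe : ∀ q p r : ℤ, 0 < q → (q:ℝ)^(1+t) < T →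
      ¬ ((q:ℝ)^s * |(q:ℝ) * θ - p| < c ∧ (q:ℝ)^t * |(q:ℝ) * y - r| < c))
    (D p r : ℤ) (hD : D ≠ 0) (h : |(D:ℝ)|^(1+t) < T) (h1 : |(D:ℝ)|^s * |(p:ℝ) - D * θ| < c)
    (h2 : |(D:ℝ)|^t * |(D:ℝ) * y - r| < c) : False := by
  rcases lt_or_gt_of_ne hD with hneg | hpos
  · have hn : (D:ℝ) < 0 := by exact_mod_cast hneg
    rw [abs_of_neg hn] at h h1 h2
    refine safe (-D) (-p) (-r) (by omega) (by push_cast; exact h) ⟨?_, ?_⟩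
    · push_cast
      have : (-(D:ℝ)) * θ - -p = p - D * θ := by ring
      rw [this]; exact h1
    · push_cast
      have : (-(D:ℝ)) * y - -r = -(D * y - r) := by ring
      rw [this, abs_neg]; exact h2
  · have hn : (0:ℝ) < D := by exact_mod_cast hpos
    rw [abs_of_pos hn] at h h1 h2
    refine safe D p r hpos h ⟨?_, h2⟩
    rw [abs_sub_comm]; exact h1

set_option maxHeartbeats 2000000 in
/-- `K = G^(k+N)`, `X = R^k`. -/
theorem tiny_pos {s t θ c y y' H G K X ρ R : ℝ} {q p r A B C q' p' r' A' B' C' : ℤ}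
    (hs : 0 ≤ s) (ht : 0 ≤ t) (hst : s + t = 1) (hH : 0 < H) (hG : 1 ≤ G) (hR : 64 ≤ R)
    (hX : 1 ≤ X) (hK : X * G^2 * R^7 ≤ K^t) (hK0 : 1 ≤ K)
    (hρ : 0 < ρ) (hρ1 : ρ ≤ 1) (hc : c = ρ / R^3)
    (P : PtG s t θ c y q p r A B C) (P' : PtG s t θ c y' q' p' r' A' B' C')
    (hl : H ≤ (q:ℝ) * |(B:ℝ)|) (hu : (q:ℝ) * |(B:ℝ)| < R * H)
    (hq1 : H * K ≤ (q:ℝ)^(1+t)) (hq : (q:ℝ)^(1+t) < H * (K * G))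
    (hl' : H ≤ (q':ℝ) * |(B':ℝ)|) (hu' : (q':ℝ) * |(B':ℝ)| < R * H)
    (hq1' : H * K ≤ (q':ℝ)^(1+t)) (hq' : (q':ℝ)^(1+t) < H * (K * G))
    (safe : ∀ q p r : ℤ, 0 < q → (q:ℝ)^(1+t) < H / X →
      ¬ ((q:ℝ)^s * |(q:ℝ) * θ - p| < c ∧ (q:ℝ)^t * |(q:ℝ) * y - r| < c))
    (hy : |y - y'| ≤ ρ * X / H) : |y - y'| ≤ 4 * c / H := by
  have hR0 : 0 < R := by linarith
  have hK' : 0 < K := by linarith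
  have hG' : 0 < G := by linarith
  have hX' : 0 < X := by linarith
  have hc0 : 0 < c := by rw [hc]; positivity
  have hcρ : 4 * c ≤ ρ := by
    rw [hc]
    rw [← mul_div_assoc, div_le_iff₀ (by positivity)]
    have : (64:ℝ)^3 ≤ R^3 := by gcongr
    nlinarith
  have n1 := P.near' hH hl
  have n2 := P'.near' hH hl'
  -- the distance of the two intersection points
  have hY : |yL θ A B C - yL θ A' B' C'| ≤ 2 * ρ * X / H := by
    have a1 := abs_sub_le (yL θ A B C) y (yL θ A' B' C')
    have a2 := abs_sub_le y y' (yL θ A' B' C')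
    rw [abs_sub_comm y' (yL θ A' B' C')] at a2
    have : 2 * c / H + 2 * c / H ≤ ρ * X / H := by
      rw [← add_div]
      have : ρ * 1 ≤ ρ * X := by gcongr
      gcongr
      linarith
    have : 2 * ρ * X / H = ρ * X / H + ρ * X / H := by ring
    linarith
  by_cases hYY : yL θ A B C = yL θ A' B' C'
  · rw [hYY] at n1
    have := abs_sub_le y (yL θ A' B' C') y'
    rw [abs_sub_comm y (yL θ A' B' C')] at this
    have : 4 * c / H = 2 * c / H + 2 * c / H := by ring
    linarith
  exfalso
  have hqp : (1:ℝ) ≤ q := by exact_mod_cast P.hq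
  have hqp' : (1:ℝ) ≤ q' := by exact_mod_cast P'.hq
  have hq0 : (0:ℝ) < q := by linarith
  have hq0' : (0:ℝ) < q' := by linarith
  have hB : (B:ℝ) ≠ 0 := by exact_mod_cast P.hB
  have hB' : (B':ℝ) ≠ 0 := by exact_mod_cast P'.hB
  have cθ := cross_theta (θ := θ) (A := A) (C := C) (A' := A') (C' := C') P.hB P'.hB
  have cy := cross_y (θ := θ) (A := A) (C := C) (A' := A') (C' := C') P.hB P'.hB
  set D : ℤ := A * B' - A' * B with hDdef
  set pz : ℤ := B * C' - B' * C with hpz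
  set rz : ℤ := C * A' - A * C' with hrz
  have hKt : K^t ≤ K := by
    conv_rhs => rw [← Real.rpow_one K]
    exact Real.rpow_le_rpow_of_exponent_le hK0 (by linarith)
  have hKK : X * G^2 * R^7 ≤ K := hK.trans hKt
  have hKs : 1 ≤ K^s := Real.one_le_rpow hK0 hs
  -- Q
  obtain ⟨Q, hQ, hQe⟩ : ∃ Q : ℝ, 0 < Q ∧ Q^(1+t) = H * K := by
    refine ⟨(H*K)^(1/(1+t)), by positivity, ?_⟩
    rw [← Real.rpow_mul (by positivity), one_div, inv_mul_cancel₀ (by linarith), Real.rpow_one]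
  have hQt : 0 < Q^t := by positivity
  have hQs : 0 < Q^s := by positivity
  have hQQ : Q * Q^t = H * K := by rw [← hQe, Real.rpow_add hQ, Real.rpow_one]
  have hQst : Q^s * Q^t = Q := by rw [← Real.rpow_add hQ, hst, Real.rpow_one]
  have low : ∀ {u : ℝ}, 0 < u → H * K ≤ u^(1+t) → Q ≤ u := by
    intro u hu h
    rw [← hQe] at h
    exact (Real.rpow_le_rpow_iff hQ.le hu.le (by linarith)).mp h
  have upp : ∀ {u : ℝ}, 0 < u → u^(1+t) < H * (K * G) → u ≤ Q * G := by
    intro u hu h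
    refine (Real.rpow_le_rpow_iff hu.le (by positivity) (by linarith : 0 < 1 + t)).mp ?_
    rw [Real.mul_rpow hQ.le hG'.le, hQe]
    have h6 : G ≤ G^(1+t) := by
      conv_lhs => rw [← Real.rpow_one G]
      exact Real.rpow_le_rpow_of_exponent_le hG (by linarith)
    calc u^(1+t) ≤ H * K * G := by linarith
      _ ≤ _ := by gcongr
  have hAb : ∀ {u a : ℝ}, 0 < u → u ≤ Q * G → a ≤ u^s → a ≤ Q^s * G := by
    intro u a hu h1 h2
    calc a ≤ u^s := h2
      _ ≤ (Q*G)^s := Real.rpow_le_rpow hu.le h1 hs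
      _ = Q^s * G^s := Real.mul_rpow hQ.le hG'.le
      _ ≤ Q^s * G^(1:ℝ) := by gcongr; linarith
      _ = _ := by rw [Real.rpow_one]
  have hBb : ∀ {u b : ℝ}, 0 < u → Q ≤ u → 0 ≤ b → u * b < R * H → b ≤ R * H / Q := by
    intro u b hu h1 hb h2
    rw [le_div_iff₀ hQ]
    have : b * Q ≤ b * u := by gcongr
    linarith
  have A1 := hAb hq0 (upp hq0 hq) P.hA
  have A2 := hAb hq0' (upp hq0' hq') P'.hA
  have B1 := hBb hq0 (low hq0 hq1) (abs_nonneg _) hu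
  have B2 := hBb hq0' (low hq0' hq1') (abs_nonneg _) hu'
  -- R H Q^s / Q = R Q / K
  have hcore : Q^s * G * (R * H / Q) = G * R * (Q / K) := by
    have : Q^s * H * K = Q * Q := by
      calc Q^s * H * K = Q^s * (H * K) := by ring
        _ = (Q^s * Q^t) * Q := by rw [← hQQ]; ring
        _ = _ := by rw [hQst]
    field_simp
    linarith
  have hAB : |(A:ℝ)| * |(B':ℝ)| ≤ G * R * (Q / K) := by
    rw [← hcore]; gcongr
  have hAB' : |(A':ℝ)| * |(B:ℝ)| ≤ G * R * (Q / K) := by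
    rw [← hcore]; gcongr
  have hDb : |(D:ℝ)| ≤ 2 * G * R * (Q / K) := by
    rw [hDdef]; push_cast
    refine (abs_sub _ _).trans ?_
    rw [abs_mul, abs_mul]; linarith
  have hW : 1 ≤ 2 * G * R := by
    have : 2 * 1 * 64 ≤ 2 * G * R := by gcongr
    linarith
  have hYn : |(pz:ℝ) - D * θ| = |(B:ℝ)| * |(B':ℝ)| * |yL θ A B C - yL θ A' B' C'| := by
    rw [← cθ, abs_mul, abs_mul]
  have hDne : D ≠ 0 := by
    intro hD0
    rw [hD0] at hYn
    have hlt : |(pz:ℝ)| < 1 := by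
      have e : |(pz:ℝ)| = |(B:ℝ)| * |(B':ℝ)| * |yL θ A B C - yL θ A' B' C'| := by
        rw [← hYn]; simp
      have sq : ∀ {u : ℝ}, 1 ≤ u → H * K ≤ u^(1+t) → H * K ≤ u^2 := by
        intro u hu h
        refine h.trans ?_
        rw [← Real.rpow_natCast u 2]
        apply Real.rpow_le_rpow_of_exponent_le hu
        push_cast; linarith
      have q1 := sq hqp hq1
      have q2 := sq hqp' hq1'
      have hqq : H * K ≤ q * q' := by
        by_contra hcon
        push Not at hcon
        have : ((q:ℝ) * q') * (q * q') < (H*K) * (H*K) := by gcongr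
        have : (H*K) * (H*K) ≤ (q:ℝ)^2 * (q':ℝ)^2 := by gcongr
        have : ((q:ℝ) * q') * (q * q') = (q:ℝ)^2 * (q':ℝ)^2 := by ring
        linarith
      have hbb : |(B:ℝ)| * |(B':ℝ)| * (H * K) ≤ (R * H)^2 := by
        calc |(B:ℝ)| * |(B':ℝ)| * (H * K) ≤ |(B:ℝ)| * |(B':ℝ)| * (q * q') := by gcongr
          _ = (q * |(B:ℝ)|) * (q' * |(B':ℝ)|) := by ring
          _ ≤ (R * H) * (R * H) := by gcongr
          _ = _ := by ring
      rw [e]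
      have h5 : |(B:ℝ)| * |(B':ℝ)| ≤ R^2 * H / K := by
        rw [le_div_iff₀ hK']
        have : |(B:ℝ)| * |(B':ℝ)| * K * H ≤ R^2 * H * H := by linarith
        exact le_of_mul_le_mul_right this hH
      calc |(B:ℝ)| * |(B':ℝ)| * |yL θ A B C - yL θ A' B' C'| ≤ R^2 * H / K * (2 * ρ * X / H) := by gcongr
        _ = 2 * ρ * X * R^2 / K := by field_simp
        _ < 1 := by
          rw [div_lt_one hK']
          refine lt_of_lt_of_le ?_ hKK
          have : (2:ℝ) < R^5 := by
            have : (64:ℝ)^5 ≤ R^5 := by gcongr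
            linarith
          calc 2 * ρ * X * R^2 ≤ 2 * 1 * X * R^2 := by gcongr
            _ = X * 1^2 * (2 * R^2) := by ring
            _ < X * 1^2 * (R^5 * R^2) := by gcongr
            _ ≤ X * G^2 * (R^5 * R^2) := by gcongr
            _ = _ := by ring
    have h0 : pz = 0 := by
      have : |pz| < 1 := by exact_mod_cast hlt
      exact Int.abs_lt_one_iff.mp this
    rw [hD0, h0] at cθ
    have : (B:ℝ) * B' * (yL θ A B C - yL θ A' B' C') = 0 := by rw [cθ]; simp
    have := (mul_eq_zero.mp this).resolve_left (mul_ne_zero hB hB')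
    exact hYY (by linarith)
  have hDpos : 0 < |(D:ℝ)| := abs_pos.mpr (by exact_mod_cast hDne)
  have powb : ∀ {e : ℝ}, 0 ≤ e → e ≤ 1 → |(D:ℝ)|^e ≤ 2 * G * R * (Q^e / K^e) := by
    intro e he he1
    calc |(D:ℝ)|^e ≤ (2 * G * R * (Q / K))^e := Real.rpow_le_rpow hDpos.le hDb he
      _ = (2 * G * R)^e * (Q / K)^e := Real.mul_rpow (by positivity) (by positivity)
      _ = (2 * G * R)^e * (Q^e / K^e) := by rw [Real.div_rpow hQ.le hK'.le]
      _ ≤ (2 * G * R)^(1:ℝ) * (Q^e / K^e) := by gcongr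
      _ = _ := by rw [Real.rpow_one]
  have hKtpos : 0 < K^t := by positivity
  have hKspos : 0 < K^s := by positivity
  refine safe_signed safe D pz rz hDne ?_ ?_ ?_
  · calc |(D:ℝ)|^(1+t) = |(D:ℝ)| * |(D:ℝ)|^t := by rw [Real.rpow_add hDpos, Real.rpow_one]
      _ ≤ (2 * G * R * (Q / K)) * (2 * G * R * (Q^t / K^t)) := by
        have := powb ht (by linarith); gcongr
      _ = 4 * G^2 * R^2 * ((Q * Q^t) / K) / K^t := by field_simp; ring
      _ = 4 * G^2 * R^2 * H / K^t := by rw [hQQ]; field_simp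
      _ < H / X := by
        rw [div_lt_div_iff₀ hKtpos hX']
        have : (4:ℝ) < R^5 := by
          have : (64:ℝ)^5 ≤ R^5 := by gcongr
          linarith
        calc 4 * G^2 * R^2 * H * X < R^5 * G^2 * R^2 * H * X := by gcongr
          _ = H * (X * G^2 * R^7) := by ring
          _ ≤ _ := by gcongr
  · rw [hYn]
    calc |(D:ℝ)|^s * (|(B:ℝ)| * |(B':ℝ)| * |yL θ A B C - yL θ A' B' C'|)
        ≤ (2 * G * R * (Q^s / K^s)) * ((R * H / Q) * (R * H / Q) * (2 * ρ * X / H)) := by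
          have := powb hs (by linarith); gcongr
      _ = 4 * ρ * G * R^3 * X / K^s * (Q^s * H / (Q * Q)) := by field_simp; ring
      _ = 4 * ρ * G * R^3 * X / K^s * (1 / K) := by
          congr 1
          rw [div_eq_div_iff (by positivity) (by positivity)]
          calc Q^s * H * K = Q^s * (H * K) := by ring
            _ = (Q^s * Q^t) * Q := by rw [← hQQ]; ring
            _ = _ := by rw [hQst]; ring
      _ ≤ 4 * ρ * G * R^3 * X / 1 * (1 / K) := by gcongr
      _ = 4 * ρ * G * R^3 * X / K := by ring
      _ < c := by
        rw [hc, div_lt_div_iff₀ hK' (by positivity)]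
        calc 4 * ρ * G * R^3 * X * R^3 = ρ * (X * (G * 1) * (4 * R^6)) := by ring
          _ < ρ * (X * (G * 1) * (R * R^6)) := by gcongr; linarith
          _ ≤ ρ * (X * (G * G) * (R * R^6)) := by gcongr
          _ = ρ * (X * G^2 * R^7) := by ring
          _ ≤ _ := by gcongr
  · have hDy : |(D:ℝ) * y - rz| ≤ 6 * G * R * ρ * X * (Q / K) / H := by
      have e : (D:ℝ) * y - rz = (A:ℝ) * B' * (yL θ A B C - yL θ A' B' C') - D * (yL θ A B C - y) := by
        rw [← cy]; ring
      rw [e]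
      refine (abs_sub _ _).trans ?_
      rw [abs_mul, abs_mul, abs_mul]
      have m1 : |(A:ℝ)| * |(B':ℝ)| * |yL θ A B C - yL θ A' B' C'| ≤ G * R * (Q / K) * (2 * ρ * X / H) := by
        gcongr
      have m2 : |(D:ℝ)| * |yL θ A B C - y| ≤ 2 * G * R * (Q / K) * (2 * ρ * X / H) := by
        have : 2 * c / H ≤ 2 * ρ * X / H := by
          have : ρ * 1 ≤ ρ * X := by gcongr
          exact div_le_div_of_nonneg_right (by linarith) hH.le
        have := n1.trans this
        gcongr
      have : 6 * G * R * ρ * X * (Q / K) / H = G * R * (Q / K) * (2 * ρ * X / H) +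
        2 * G * R * (Q / K) * (2 * ρ * X / H) := by ring
      linarith
    calc |(D:ℝ)|^t * |(D:ℝ) * y - rz| ≤ (2 * G * R * (Q^t / K^t)) * (6 * G * R * ρ * X * (Q / K) / H) := by
          have := powb ht (by linarith); gcongr
      _ = 12 * G^2 * R^2 * ρ * X * ((Q * Q^t) / (K * H)) / K^t := by field_simp; ring
      _ = 12 * G^2 * R^2 * ρ * X / K^t := by rw [hQQ]; field_simp
      _ < c := by
        rw [hc, div_lt_div_iff₀ hKtpos (by positivity)]
        have : (12:ℝ) < R^2 := by
          have : (64:ℝ)^2 ≤ R^2 := by gcongr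
          linarith
        calc 12 * G^2 * R^2 * ρ * X * R^3 < R^2 * G^2 * R^2 * ρ * X * R^3 := by gcongr
          _ = ρ * (X * G^2 * R^7) := by ring
          _ ≤ _ := by gcongr

def EG (s t θ c h R G : ℝ) (N : ℕ) (i : ℕ × ℕ) : Set ℝ :=
  {y | ∃ q p r A B C : ℤ, PtG s t θ c y q p r A B C ∧ h * R^(i.1+i.2) ≤ (q:ℝ) * |(B:ℝ)| ∧
    (q:ℝ) * |(B:ℝ)| < R * (h * R^(i.1+i.2)) ∧
    (q:ℝ)^(1+t) < h * R^(i.1+i.2) * (G^(i.2+N) * G) ∧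
    (i.2 = 0 ∨ h * R^(i.1+i.2) * G^(i.2+N) ≤ (q:ℝ)^(1+t))}

theorem cover {s t θ c h R G c0 : ℝ} {N : ℕ} (ht : 0 ≤ t) (ht1 : t ≤ 1)
    (hh : 0 < h) (hh1 : h ≤ 1) (hR : 1 < R) (hRG : R ≤ G) (hN : 2 ≤ N) (hc : c ≤ c0)
    (lines : ∀ q p r : ℤ, 0 < q → (q:ℝ)^s * |(q:ℝ) * θ - p| < c0 →
      ∃ A B C : ℤ, B ≠ 0 ∧ (|A| : ℝ) ≤ (q:ℝ)^s ∧ (|B| : ℝ) ≤ (q:ℝ)^t ∧ A * p + B * r + C * q = 0)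
    (m : ℕ) (y : ℝ) (q p r : ℤ) (hq : 0 < q) (hqm : (q:ℝ)^(1+t) < h * R^m)
    (h1 : (q:ℝ)^s * |(q:ℝ) * θ - p| < c) (h2 : (q:ℝ)^t * |(q:ℝ) * y - r| < c) :
    ∃ i : ℕ × ℕ, i.1 + i.2 < m ∧ y ∈ EG s t θ c h R G N i := by
  obtain ⟨A, B, C, hB, hA, hBt, hL⟩ := lines q p r hq (h1.trans_le hc)
  have P : PtG s t θ c y q p r A B C := ⟨hq, h1, h2, hB, hA, hBt, hL⟩
  have hq1 : (1:ℝ) ≤ q := by exact_mod_cast hq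
  have hq0 : (0:ℝ) < q := by linarith
  have hB1 : (1:ℝ) ≤ |(B:ℝ)| := by exact_mod_cast Int.one_le_abs hB
  have hu1 : (1:ℝ) ≤ q * |(B:ℝ)| := by nlinarith
  have hG : 1 < G := by linarith
  have hR0 : 0 < R := by linarith
  have huv : (q:ℝ) * |(B:ℝ)| ≤ (q:ℝ)^(1+t) := by
    rw [Real.rpow_add hq0, Real.rpow_one]; gcongr
  obtain ⟨n, hn1, hn2⟩ := exists_nat_pow_near
    (x := (q:ℝ) * |(B:ℝ)| / h) (by rw [le_div_iff₀ hh]; linarith) hR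
  rw [le_div_iff₀ hh] at hn1
  rw [div_lt_iff₀ hh] at hn2
  have hHn : 0 < h * R^n := by positivity
  have hnm : n < m := by
    have : R^n * h < R^m * h := by linarith
    exact (pow_lt_pow_iff_right₀ hR).mp (lt_of_mul_lt_mul_right this hh.le)
  have hn2' : (q:ℝ) * |(B:ℝ)| < R * (h * R^n) := by
    rw [pow_succ] at hn2; linarith
  obtain ⟨j, hj1, hj2⟩ := exists_nat_pow_near
    (x := (q:ℝ)^(1+t) / (h * R^n)) (by rw [le_div_iff₀ hHn]; linarith) hG
  rw [le_div_iff₀ hHn] at hj1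
  rw [div_lt_iff₀ hHn] at hj2
  by_cases hj : j ≤ N
  · refine ⟨(n, 0), by simpa using hnm, q, p, r, A, B, C, P, ?_, ?_, ?_, Or.inl rfl⟩
    · simp only [add_zero]; linarith
    · simpa using hn2'
    · simp only [add_zero, zero_add]
      rw [← pow_succ]
      refine hj2.trans_le ?_
      rw [mul_comm]
      gcongr
      exact hG.le
  · push Not at hj
    have hkn : j < n + 2 := by
      have a1 : R^j ≤ G^j := by gcongr
      have a2 : (q:ℝ)^(1+t) ≤ (q * |(B:ℝ)|)^2 := by
        calc (q:ℝ)^(1+t) ≤ (q:ℝ)^(2:ℝ) := Real.rpow_le_rpow_of_exponent_le hq1 (by linarith)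
          _ = (q * 1)^2 := by rw [mul_one]; exact_mod_cast Real.rpow_natCast (q:ℝ) 2
          _ ≤ _ := by gcongr
      have a3 : (q * |(B:ℝ)|)^2 < (R * (h * R^n))^2 := by gcongr
      have a4 : R^j * (h * R^n) < (R^2 * h * R^n) * (h * R^n) := by
        calc R^j * (h * R^n) ≤ G^j * (h * R^n) := by gcongr
          _ < (R * (h * R^n))^2 := by linarith
          _ = _ := by ring
      have a5 := lt_of_mul_lt_mul_right a4 hHn.le
      have a6 : R^2 * h * R^n ≤ R^(n+2) := by
        calc R^2 * h * R^n ≤ R^2 * 1 * R^n := by gcongr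
          _ = _ := by ring
      exact (pow_lt_pow_iff_right₀ hR).mp (a5.trans_le a6)
    refine ⟨(n - (j - N), j - N), ?_, q, p, r, A, B, C, P, ?_⟩
    · simp only; omega
    · have e1 : n - (j - N) + (j - N) = n := by omega
      have e2 : j - N + N = j := by omega
      simp only [e1, e2]
      refine ⟨by linarith, hn2', ?_, Or.inr (by linarith)⟩
      rw [← pow_succ]; linarith

theorem core (s t θ : ℝ) (hs : 0 ≤ s) (ht : 0 ≤ t) (hst : s + t = 1)
    (hθ : s ≠ 0 → 0 < ⨅ q : {q : ℕ // 0 < q}, (q : ℝ) ^ (1 / s) * dInt ((q : ℝ) * θ))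
    (β : ℝ) (hβ : 0 < β) (hβ1 : β < 1) (L : ℝ) (hL : 0 < L) :
    ∃ E : ℕ × ℕ → Set ℝ, (∀ (m : ℕ) (a b : ℝ), b - a = L * (β/2)^(6*m) →
      (∀ i : ℕ × ℕ, i.1 + i.2 < m → ∀ x ∈ E i, x ∉ Set.Icc a b) →
      ∀ k : ℕ, ∀ x ∈ E (m, k), ∀ y ∈ E (m, k), x ∈ Set.Icc a b → y ∈ Set.Icc a b →
        |x - y| < β / 4 * (L * (β/2)^(6*(m+k+1)))) ∧
      ∀ y, (∀ i, y ∉ E i) → y ∈ BadST s t θ := by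
  have fin : ∀ c : ℝ, 0 < c → ∀ y, (∀ q p r : ℤ, 0 < q →
      ¬ ((q:ℝ)^s * |(q:ℝ) * θ - p| < c ∧ (q:ℝ)^t * |(q:ℝ) * y - r| < c)) → y ∈ BadST s t θ := by
    intro c hc y h
    have : Nonempty {q : ℕ // 0 < q} := ⟨⟨1, one_pos⟩⟩
    refine lt_of_lt_of_le hc (le_ciInf ?_)
    rintro ⟨q, hq⟩
    by_contra hcon
    rw [not_le, max_lt_iff] at hcon
    have hq0 : (0:ℝ) < q := by exact_mod_cast hq
    obtain ⟨c1, c2⟩ := hcon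
    simp only at c1 c2
    rw [← lt_div_iff₀' (by positivity)] at c1 c2
    obtain ⟨p, hp⟩ := exists_lt_of_ciInf_lt c1
    obtain ⟨r, hr⟩ := exists_lt_of_ciInf_lt c2
    rw [lt_div_iff₀' (by positivity)] at hp hr
    exact h q p r (by exact_mod_cast hq) ⟨by exact_mod_cast hp, by exact_mod_cast hr⟩
  obtain ⟨c0, hc0, lines⟩ := lines_exist s t θ hs ht hst hθ
  rcases ht.eq_or_lt with h0 | ht0
  · refine ⟨fun _ => ∅, by simp, fun y _ => ?_⟩
    have hs1 : s = 1 := by linarith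
    have hc := hθ (by rw [hs1]; norm_num)
    refine lt_of_lt_of_le hc (ciInf_mono ?_ ?_)
    · refine ⟨0, ?_⟩
      rintro _ ⟨n, rfl⟩
      exact mul_nonneg (by positivity) (dInt_nonneg _)
    · intro q
      rw [hs1, one_div_one]
      exact le_max_left _ _
  set R : ℝ := (2/β)^6 with hRdef
  have hb2 : 2 ≤ 2/β := by rw [le_div_iff₀ hβ]; linarith
  have hR64 : 64 ≤ R := by
    calc (64:ℝ) = 2^6 := by norm_num
      _ ≤ _ := by rw [hRdef]; gcongr
  have hRβ : 64 ≤ β * R := by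
    have : R = (2/β)^5 * (2/β) := by rw [hRdef]; ring
    rw [this]
    have e : β * ((2/β)^5 * (2/β)) = 2 * (2/β)^5 := by field_simp
    rw [e]
    have : (2:ℝ)^5 ≤ (2/β)^5 := by gcongr
    linarith
  have hR1 : 1 < R := by linarith
  have hR0 : 0 < R := by linarith
  have hRinv : ∀ n : ℕ, (β/2)^(6*n) = 1 / R^n := by
    intro n
    rw [hRdef, ← pow_mul, one_div, ← inv_pow, inv_div]
  obtain ⟨ν, hν⟩ := exists_nat_ge (1/t)
  rw [div_le_iff₀ ht0] at hν
  have hν1 : 1 ≤ ν := by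
    rcases Nat.eq_zero_or_pos ν with h | h
    · rw [h] at hν; norm_num at hν
    · exact h
  set G : ℝ := R^ν with hGdef
  have hRG : R ≤ G := by
    calc R = R^1 := (pow_one R).symm
      _ ≤ _ := pow_le_pow_right₀ hR1.le hν1
  have hG1 : 1 ≤ G := by linarith
  have hGt : R ≤ G^t := by
    rw [hGdef, ← Real.rpow_natCast, ← Real.rpow_mul hR0.le]
    conv_lhs => rw [← Real.rpow_one R]
    exact Real.rpow_le_rpow_of_exponent_le hR1.le hν
  set N : ℕ := 2*ν+7 with hN
  set ρ : ℝ := min L (min c0 (1/(6*R*(G^N*G)))) with hρdef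
  have hρ : 0 < ρ := by
    rw [hρdef]; refine lt_min hL (lt_min hc0 (by positivity))
  have hρL : ρ ≤ L := min_le_left _ _
  have hρc0 : ρ ≤ c0 := (min_le_right _ _).trans (min_le_left _ _)
  have hρ3 : ρ ≤ 1/(6*R*(G^N*G)) := (min_le_right _ _).trans (min_le_right _ _)
  have hM1 : 1 ≤ G^N*G := by
    have : 1 ≤ G^N := one_le_pow₀ hG1
    nlinarith
  have hsmall : 5 * ρ * R * (G^N*G) < 1 := by
    rw [le_div_iff₀ (by positivity)] at hρ3
    have : 0 < ρ * R * (G^N*G) := by positivity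
    linarith
  have hρ1 : ρ ≤ 1 := by
    have : 5 * ρ * 1 * 1 ≤ 5 * ρ * R * (G^N*G) := by gcongr
    linarith
  set c : ℝ := ρ / R^3 with hc
  have hcpos : 0 < c := by positivity
  have hcρ : c ≤ ρ := by
    rw [hc]; exact div_le_self hρ.le (one_le_pow₀ hR1.le)
  set h : ℝ := ρ / L with hh
  have hhpos : 0 < h := by positivity
  have hh1 : h ≤ 1 := by rw [hh, div_le_one hL]; exact hρL
  have cov := fun (m : ℕ) (y : ℝ) (q p r : ℤ) => cover (c := c) (h := h) (R := R) (G := G) (N := N) ht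
    (by linarith : t ≤ 1) hhpos hh1 hR1 hRG (by omega) (hcρ.trans hρc0) lines m y q p r
  refine ⟨EG s t θ c h R G N, ?_, ?_⟩
  · intro m a b hab dead k x hx y hy hxI hyI
    have safe : ∀ q p r : ℤ, 0 < q → (q:ℝ)^(1+t) < h * R^m →
      ¬ ((q:ℝ)^s * |(q:ℝ) * θ - p| < c ∧ (q:ℝ)^t * |(q:ℝ) * x - r| < c) := by
      rintro q p r hq hlt ⟨h1, h2⟩
      obtain ⟨i, hi, hxi⟩ := cov m x q p r hq hlt h1 h2
      exact dead i hi x hxi hxI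
    have hxy : |x - y| ≤ ρ / (h * R^m) := by
      have e : ρ / (h * R^m) = b - a := by
        rw [hab, hRinv, hh]; field_simp
      rw [e, abs_le]
      constructor <;> linarith [hxI.1, hxI.2, hyI.1, hyI.2]
    have key : |x - y| ≤ 4 * c / (h * R^(m+k)) := by
      obtain ⟨q, p, r, A, B, C, P, e1, e2, e3, e4⟩ := hx
      obtain ⟨q', p', r', A', B', C', P', e1', e2', e3', e4'⟩ := hy
      simp only at e1 e2 e3 e4 e1' e2' e3' e4'
      rcases Nat.eq_zero_or_pos k with hk | hk
      · subst hk
        simp only [add_zero, zero_add] at e1 e2 e3 e1' e2' e3' ⊢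
        exact tiny_zero hs ht hst (by positivity) hM1 hR1.le hcpos hcρ hsmall P P'
          e1 e2 e3 e1' e2' e3' hxy
      · have e5 := e4.resolve_left (by omega)
        have e5' := e4'.resolve_left (by omega)
        have eH : h * R^(m+k) / R^k = h * R^m := by rw [pow_add]; field_simp
        refine tiny_pos (X := R^k) (K := G^(k+N)) hs ht hst (by positivity) hG1 hR64
          (one_le_pow₀ hR1.le) ?_ (one_le_pow₀ hG1) hρ hρ1 hc P P' e1 e2 e5 e3 e1' e2' e5' e3' ?_ ?_
        · have : (G^(k+N))^t = (G^t)^(k+N) := by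
            rw [← Real.rpow_natCast, ← Real.rpow_mul (by positivity), mul_comm, Real.rpow_mul (by positivity),
              Real.rpow_natCast]
          rw [this]
          calc R^k * G^2 * R^7 = R^(k+N) := by rw [hGdef, hN]; ring
            _ ≤ _ := by gcongr
        · rw [eH]; exact safe
        · refine hxy.trans (le_of_eq ?_)
          rw [← eH]; field_simp
    refine key.trans_lt ?_
    rw [hRinv, hh, hc]
    have e1 : 4 * (ρ / R^3) / (ρ / L * R^(m+k)) = 4 * (L / R^(m+k+1)) / R^2 := by
      rw [pow_succ]; field_simp; ring
    have e2 : β / 4 * (L * (1 / R^(m+k+1))) = β / 4 * (L / R^(m+k+1)) := by ring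
    rw [e1, e2, div_lt_iff₀ (by positivity)]
    have : 0 < L / R^(m+k+1) := by positivity
    have h16 : 4 < β / 4 * R^2 := by nlinarith
    calc 4 * (L / R^(m+k+1)) < (β / 4 * R^2) * (L / R^(m+k+1)) := by gcongr
      _ = _ := by ring
  · intro y hy
    refine fin c hcpos y ?_
    rintro q p r hq ⟨h1, h2⟩
    obtain ⟨m, hm⟩ := pow_unbounded_of_one_lt ((q:ℝ)^(1+t) / h) hR1
    rw [div_lt_iff₀ hhpos] at hm
    obtain ⟨i, _, hi⟩ := cov m y q p r hq (by linarith) h1 h2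
    exact hy i hi

theorem badST_half_winning (s t θ : ℝ) (hs : 0 ≤ s) (ht : 0 ≤ t) (hst : s + t = 1)
    (hθ : s ≠ 0 → 0 < ⨅ q : {q : ℕ // 0 < q}, (q : ℝ) ^ (1 / s) * dInt ((q : ℝ) * θ)) :
    ∀ β : ℝ, 0 < β → β < 1 →
      ∃ f : List (ℝ × ℝ) → ℝ × ℝ,
        ∀ B A : ℕ → ℝ × ℝ,
          (∀ n : ℕ, A n = f (List.ofFn fun i : Fin (n + 1) => B i)) →
          (B 0).1 < (B 0).2 →
          (∀ n : ℕ, Set.Icc (B (n + 1)).1 (B (n + 1)).2 ⊆ Set.Icc (A n).1 (A n).2 ∧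
            (B (n + 1)).2 - (B (n + 1)).1 = β * ((A n).2 - (A n).1)) →
          (∀ n : ℕ, Set.Icc (A n).1 (A n).2 ⊆ Set.Icc (B n).1 (B n).2 ∧
            (A n).2 - (A n).1 = (1 / 2) * ((B n).2 - (B n).1)) ∧
          ∀ x : ℝ, (∀ n : ℕ, x ∈ Set.Icc (A n).1 (A n).2) → x ∈ BadST s t θ := by
  intro β hβ hβ1
  choose E hE1 hE2 using core s t θ hs ht hst hθ β hβ hβ1
  classical
  obtain ⟨F, hF⟩ : ∃ F : ℝ → ℕ × ℕ → Set ℝ, ∀ L (h : 0 < L), F L = E L h :=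
    ⟨fun L => if h : 0 < L then E L h else fun _ => ∅, fun L h => dif_pos h⟩
  refine ⟨fun l => greedyG wG (F ((l.headD (0,0)).2 - (l.headD (0,0)).1))
    {i | i.1 ≤ (l.length - 1) / 6} (l.getLastD (0,0)), ?_⟩
  intro B A hA h0 hB
  have hL : 0 < (B 0).2 - (B 0).1 := by linarith
  have hA' : ∀ n, A n = greedyG wG (E _ hL) {i | i.1 ≤ n / 6} (B n) := by
    intro n
    have e1 : (List.ofFn fun i : Fin (n + 1) => B i).headD (0,0) = B 0 := by
      simp [List.ofFn_succ]
    have e2 : (List.ofFn fun i : Fin (n + 1) => B i).getLastD (0,0) = B n := by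
      rw [List.getLastD_eq_getLast?, List.getLast?_eq_getElem?, List.length_ofFn,
        Nat.add_sub_cancel, List.getElem?_ofFn]
      simp
    have e3 : (List.ofFn fun i : Fin (n + 1) => B i).length - 1 = n := by
      rw [List.length_ofFn, Nat.add_sub_cancel]
    rw [hA n]
    beta_reduce
    rw [e1, e2, e3, hF _ hL]
  obtain ⟨g1, g2⟩ := game_main β hβ hβ1 _ hL (E _ hL) (hE1 _ hL) B A hA' rfl hB
  exact ⟨g1, fun x hx => hE2 _ hL x (g2 x hx)⟩
end

section
/- Let (s_n, t_n)_{n=1}^∞ be a sequence of pairs of nonnegative real numbers with s_n + t_n = 1 for all n, let s = sup_{n ∈ ℕ} s_n, and suppose that liminf_{n→∞} min(s_n, t_n) > 0. Then for every θ ∈ ℝ with inf_{q ∈ ℕ, q ≥ 1} q^(1/s) ‖qθ‖ > 0, the set ⋂_{n=1}^∞ Bad(s_n, t_n; θ) is thick in ℝ, i.e. for every nonempty open interval I ⊆ ℝ, the Hausdorff dimension of I ∩ ⋂_{n=1}^∞ Bad(s_n, t_n; θ) equals 1. -/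
theorem linear_form_bound {A B u v a b c a' b' : ℝ} (hA : |A| ≤ a') (hB : |B| ≤ b')
   (haa : a' ≤ a) (hbb : b' ≤ b) (hu : a * |u| < c) (hv : b * |v| < c) : |A * u + B * v| < 2 * c := by
  have h1 : |A| * |u| ≤ a * |u| := mul_le_mul_of_nonneg_right (hA.trans haa) (abs_nonneg _)
  have h2 : |B| * |v| ≤ b * |v| := mul_le_mul_of_nonneg_right (hB.trans hbb) (abs_nonneg _)
  have := abs_add_le (A*u) (B*v)
  rw [abs_mul, abs_mul] at this
  linarith

structure Dat (θ c l R : ℝ) (L m k : ℕ) (y a b q : ℝ) (A B C p r : ℤ) : Prop where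
  hq : 1 ≤ q
  ha : 1 ≤ a
  hb : 1 ≤ b
  hab : a * b = q
  hu : a * |q * θ - p| < c
  hv : b * |q * y - r| < c
  hA : |(A:ℝ)| ≤ a
  hB0 : B ≠ 0
  hline : (A:ℝ) * p + B * r + C * q = 0
  hk1 : R ^ (L * k) * |(B:ℝ)| ≤ b
  hk2 : b < R ^ (L * (k+1)) * |(B:ℝ)|
  hm1 : 4 * c * R ^ (m + k + 1) ≤ l * (q * |(B:ℝ)|)
  hm2 : l * (q * |(B:ℝ)|) < 4 * c * R ^ (m + k + 2)

section
variable {θ c l R : ℝ} {L m k : ℕ} {y a b q : ℝ} {A B C p r : ℤ}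

theorem Dat.hB (h : Dat θ c l R L m k y a b q A B C p r) (hR : 1 ≤ R) : |(B:ℝ)| ≤ b := by
  have := h.hk1
  have h1 : 1 ≤ R ^ (L*k) := one_le_pow₀ hR
  nlinarith [abs_nonneg (B:ℝ)]

theorem Dat.Bpos (h : Dat θ c l R L m k y a b q A B C p r) : 1 ≤ |(B:ℝ)| := by
  have := Int.one_le_abs h.hB0
  exact_mod_cast this

theorem Dat.e_bound (h : Dat θ c l R L m k y a b q A B C p r) (hR : 1 ≤ R) :
    q * |A * θ + B * y + C| < 2 * c := by
  have h1 := linear_form_bound h.hA (h.hB hR) le_rfl le_rfl h.hu h.hv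
  have : q * |A * θ + B * y + C| = |(A:ℝ) * (q * θ - p) + B * (q * y - r)| := by
    rw [← abs_of_nonneg (show (0:ℝ) ≤ q by linarith [h.hq]), ← abs_mul, abs_of_nonneg (show (0:ℝ) ≤ q by linarith [h.hq])]
    congr 1
    linear_combination h.hline
  rw [this]; exact h1

theorem Dat.e_div (h : Dat θ c l R L m k y a b q A B C p r) (hR : 1 ≤ R) (hl : 0 < l) (hc : 0 < c) :
    |A * θ + B * y + C| / |(B:ℝ)| ≤ l / R ^ (m + k + 1) / 2 := by
  have he := h.e_bound hR
  have hBp := h.Bpos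
  generalize (A * θ + B * y + C) = e at *
  rw [div_div, div_le_div_iff₀ (by positivity) (by positivity)]
  have h1 := mul_le_mul_of_nonneg_right h.hm1 (abs_nonneg e)
  have h9 : l * |(B:ℝ)| * (q * |e|) ≤ l * |(B:ℝ)| * (2 * c) :=
    mul_le_mul_of_nonneg_left he.le (by positivity)
  have h2 : (2 * c) * (|e| * (R ^ (m+k+1) * 2)) ≤ (2 * c) * (l * |(B:ℝ)|) := by linarith
  exact le_of_mul_le_mul_left h2 (by positivity)

variable {y' a' b' q' : ℝ} {A' B' C' p' r' : ℤ}

theorem Dat.ratio (h : Dat θ c l R L m k y a b q A B C p r)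
    (h' : Dat θ c l R L m k y' a' b' q' A' B' C' p' r') (hR : 1 ≤ R) (hl : 0 < l) (hbb : b ≤ b') :
    q' ≤ R ^ (L + 1) * q := by
  have hb' : 0 < b' := by linarith [h'.hb]
  have hq := h.hq
  have hq' := h'.hq
  refine le_of_mul_le_mul_right (a := b') ?_ hb'
  have hX : 0 < R ^ (L*k) := by positivity
  refine le_of_mul_le_mul_left (a := l) ?_ hl
  have e1 : l * (q' * b') ≤ l * (q' * (R ^ (L * (k+1)) * |(B':ℝ)|)) := by
    have := h'.hk2
    gcongr
  have e2 : l * (q' * (R ^ (L * (k+1)) * |(B':ℝ)|)) ≤ R ^ (L * (k+1)) * (R * (l * (q * |(B:ℝ)|))) := by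
    have := h'.hm2
    have h3 : R * (4 * c * R ^ (m + k + 1)) ≤ R * (l * (q * |(B:ℝ)|)) := by
      have := h.hm1; gcongr
    have h4 : R ^ (L * (k+1)) * (l * (q' * |(B':ℝ)|)) ≤ R ^ (L * (k+1)) * (R * (l * (q * |(B:ℝ)|))) := by
      refine mul_le_mul_of_nonneg_left ?_ (by positivity)
      refine this.le.trans (le_trans (le_of_eq ?_) h3)
      ring
    linarith
  have e3 : R ^ (L * (k+1)) * (R * (l * (q * |(B:ℝ)|))) = R ^ (L+1) * l * q * (R ^ (L*k) * |(B:ℝ)|) := by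
    ring
  have e4 : R ^ (L+1) * l * q * (R ^ (L*k) * |(B:ℝ)|) ≤ R ^ (L+1) * l * q * b' := by
    have := h.hk1.trans hbb
    gcongr
  linarith

theorem pair_small (h : Dat θ c l R L m k y a b q A B C p r)
    (h' : Dat θ c l R L m k y' a' b' q' A' B' C' p' r') (hqi' : ∃ n : ℤ, (n:ℝ) = q') (hR : 1 ≤ R) (hl : 0 < l) (haa : a ≤ a') (hbb : b ≤ b')
    (hqq : q ≤ q') (hc : 0 < c) (hyy : |y - y'| ≤ l / R ^ m) (hcs : 8 * c * R ^ (L + 1) * R ^ (k + 2) < 1) :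
    |y - y'| ≤ l / R ^ (m + k + 1) := by
  have hq := h.hq
  have hq' := h'.hq
  have hrat := h.ratio h' hR hl hbb
  have hlin := linear_form_bound h.hA (h.hB hR) haa hbb h'.hu h'.hv
  have he := h.e_bound hR
  have hRm : 0 < R ^ m := by positivity
  obtain ⟨n', hn'⟩ := hqi'
  have hBy : q * (|(B:ℝ)| * |y - y'|) ≤ 4 * c * R ^ (k+2) := by
    have h1 : q * (|(B:ℝ)| * |y - y'|) ≤ q * (|(B:ℝ)| * (l / R ^ m)) := by gcongr
    have h2 := h.hm2
    have h3 : q * (|(B:ℝ)| * (l / R ^ m)) = l * (q * |(B:ℝ)|) / R ^ m := by field_simp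
    have h4 : l * (q * |(B:ℝ)|) / R ^ m ≤ 4 * c * R ^ (k+2) := by
      rw [div_le_iff₀ hRm]; refine h2.le.trans (le_of_eq (by ring))
    linarith
  have hX : 1 ≤ R ^ (k+2) := one_le_pow₀ hR
  have hY : 1 ≤ R ^ (L+1) := one_le_pow₀ hR
  -- the integer F
  have hF : A * p' + B * r' + C * n' = 0 := by
    rw [← Int.abs_lt_one_iff]
    have hF1 : ((A * p' + B * r' + C * n' : ℤ) : ℝ) =
        -(A * (q' * θ - p') + B * (q' * y' - r')) + q' * ((A * θ + B * y + C) - B * (y - y')) := by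
      push_cast; rw [hn']; ring
    have hF2 : |((A * p' + B * r' + C * n' : ℤ) : ℝ)| ≤ |(A * (q' * θ - p') + B * (q' * y' - r') : ℝ)| + q' * (|A * θ + B * y + C| + |(B:ℝ)| * |y - y'|) := by
      rw [hF1]
      refine (abs_add_le _ _).trans ?_
      rw [abs_neg, abs_mul, abs_of_nonneg (by linarith : 0 ≤ q')]
      gcongr
      refine (abs_sub _ _).trans ?_
      rw [abs_mul]
    have hF3 : q' * (|A * θ + B * y + C| + |(B:ℝ)| * |y - y'|) ≤ R ^ (L+1) * (2 * c + 4 * c * R ^ (k+2)) := by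
      calc q' * (|A * θ + B * y + C| + |(B:ℝ)| * |y - y'|) ≤ (R ^ (L+1) * q) * (|A * θ + B * y + C| + |(B:ℝ)| * |y - y'|) := by gcongr
        _ = R ^ (L+1) * (q * |A * θ + B * y + C| + q * (|(B:ℝ)| * |y - y'|)) := by ring
        _ ≤ _ := by gcongr
    have hF4 : |((A * p' + B * r' + C * n' : ℤ) : ℝ)| < 1 := by
      have : c ≤ c * R ^ (L+1) := by nlinarith
      have h5 : c * R ^ (L+1) ≤ c * R ^ (L+1) * R ^ (k+2) := by
        have : 0 ≤ c * R ^ (L+1) := by positivity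
        nlinarith
      nlinarith
    exact_mod_cast hF4
  have hF' : (A:ℝ) * p' + B * r' + C * q' = 0 := by rw [← hn']; exact_mod_cast hF
  have he' : q' * |A * θ + B * y' + C| < 2 * c := by
    have : q' * |A * θ + B * y' + C| = |(A:ℝ) * (q' * θ - p') + B * (q' * y' - r')| := by
      rw [← abs_of_nonneg (show (0:ℝ) ≤ q' by linarith), ← abs_mul, abs_of_nonneg (show (0:ℝ) ≤ q' by linarith)]
      congr 1
      linear_combination hF'
    rw [this]; exact hlin
  have he'' : q * |A * θ + B * y' + C| < 2 * c := by
    refine lt_of_le_of_lt ?_ he'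
    gcongr
  have hfin : q * (|(B:ℝ)| * |y - y'|) ≤ 4 * c := by
    have : |(B:ℝ)| * |y - y'| ≤ |A * θ + B * y + C| + |A * θ + B * y' + C| := by
      rw [← abs_mul]
      have : (B:ℝ) * (y - y') = (A * θ + B * y + C) - (A * θ + B * y' + C) := by ring
      rw [this]; exact abs_sub _ _
    have := mul_le_mul_of_nonneg_left this (by linarith : 0 ≤ q)
    linarith
  rw [le_div_iff₀ (by positivity)]
  have h6 := mul_le_mul_of_nonneg_right h.hm1 (abs_nonneg (y - y'))
  have h7 : l * (q * |(B:ℝ)|) * |y - y'| ≤ l * (4 * c) := by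
    have := mul_le_mul_of_nonneg_left hfin hl.le
    linarith
  have h8 : (4 * c) * (|y - y'| * R ^ (m + k + 1)) ≤ (4 * c) * l := by linarith
  exact le_of_mul_le_mul_left h8 (by positivity)

set_option maxHeartbeats 1000000 in
theorem pair_large (h : Dat θ c l R L m k y a b q A B C p r)
    (h' : Dat θ c l R L m k y' a' b' q' A' B' C' p' r') (hR : 1 ≤ R) (hl : 0 < l) (haa : a ≤ a') (hbb : b ≤ b')
    (hc : 0 < c) (hc1 : c ≤ 1) (hyy : |y - y'| ≤ l / R ^ m)
    (hL : 2 ≤ L) (hkL : 16 * R ^ (L + 3) < R ^ k)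
    (hmin : ∀ n : ℕ, 1 ≤ n → (n:ℝ) < q → (n:ℝ) ≤ 2 * q' / R ^ (L * k) →
      (∃ P S : ℤ, |(n:ℝ) * θ - P| * (q * R ^ (2 * k)) ≤ b' * (8 * c * R ^ (k + 2)) ∧
        |(n:ℝ) * y - S| * q ≤ a' * (8 * c * R ^ (k + 2))) → False) :
    |y - y'| ≤ l / R ^ (m + k + 1) := by
  have hq := h.hq
  have hq' := h'.hq
  have hrat := h.ratio h' hR hl hbb
  have he := h.e_bound hR
  have he' := h'.e_bound hR
  have hRm : 0 < R ^ m := by positivity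
  have hX : 1 ≤ R ^ (k+2) := one_le_pow₀ hR
  have hY : 1 ≤ R ^ (L+1) := one_le_pow₀ hR
  have hqq : q ≤ q' := by
    rw [← h.hab, ← h'.hab]
    have := h.ha; have := h.hb; have := h'.ha
    gcongr
  have hW : R ^ (2 * k) ≤ R ^ (L * k) := pow_le_pow_right₀ hR (Nat.mul_le_mul_right _ hL)
  have hWpos : 0 < R ^ (L * k) := by positivity
  have hBy : q' * (|(B':ℝ)| * |y - y'|) ≤ 4 * c * R ^ (k+2) := by
    have h1 : q' * (|(B':ℝ)| * |y - y'|) ≤ q' * (|(B':ℝ)| * (l / R ^ m)) := by gcongr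
    have h2 := h'.hm2
    have h3 : q' * (|(B':ℝ)| * (l / R ^ m)) = l * (q' * |(B':ℝ)|) / R ^ m := by field_simp
    have h4 : l * (q' * |(B':ℝ)|) / R ^ m ≤ 4 * c * R ^ (k+2) := by
      rw [div_le_iff₀ hRm]; refine h2.le.trans (le_of_eq (by ring))
    linarith
  set e1 : ℝ := A * θ + B * y + C with he1
  set e2 : ℝ := A' * θ + B' * y + C' with he2
  have hE1 : q * |e1| ≤ 2 * c * R ^ (k+2) := by nlinarith
  have hE2' : q' * |e2| ≤ 6 * c * R ^ (k+2) := by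
    have : |e2| ≤ |A' * θ + B' * y' + C'| + |(B':ℝ)| * |y - y'| := by
      rw [← abs_mul]
      have : e2 = (A' * θ + B' * y' + C') + B' * (y - y') := by rw [he2]; ring
      rw [this]; exact abs_add_le _ _
    have := mul_le_mul_of_nonneg_left this (by linarith : 0 ≤ q')
    nlinarith
  have hE2 : q * |e2| ≤ 6 * c * R ^ (k+2) := by
    refine le_trans ?_ hE2'
    gcongr
  have hB1 : |(B:ℝ)| * R ^ (L*k) ≤ b' := by linarith [h.hk1]
  have hB2 : |(B':ℝ)| * R ^ (L*k) ≤ b' := by linarith [h'.hk1]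
  have hA1 : |(A:ℝ)| ≤ a' := h.hA.trans haa
  have hA2 : |(A':ℝ)| ≤ a' := h'.hA
  have ha'0 : 0 ≤ a' := by linarith [h'.ha]
  have hb'0 : 0 ≤ b' := by linarith [h'.hb]
  set Q : ℤ := A * B' - A' * B with hQ
  set D : ℤ := C * B' - C' * B with hD
  set D' : ℤ := A * C' - A' * C with hD'
  have hQθ : |(Q:ℝ) * θ + D| * (q * R ^ (L * k)) ≤ b' * (8 * c * R ^ (k + 2)) := by
    have e : (Q:ℝ) * θ + D = B' * e1 - B * e2 := by rw [hQ, hD, he1, he2]; push_cast; ring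
    have : |(Q:ℝ) * θ + D| ≤ |(B':ℝ)| * |e1| + |(B:ℝ)| * |e2| := by
      rw [e, ← abs_mul, ← abs_mul]; exact abs_sub _ _
    calc |(Q:ℝ) * θ + D| * (q * R ^ (L * k)) ≤ (|(B':ℝ)| * |e1| + |(B:ℝ)| * |e2|) * (q * R ^ (L * k)) := by gcongr
      _ = (|(B':ℝ)| * R ^ (L*k)) * (q * |e1|) + (|(B:ℝ)| * R ^ (L*k)) * (q * |e2|) := by ring
      _ ≤ b' * (2 * c * R ^ (k+2)) + b' * (6 * c * R ^ (k+2)) := by gcongr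
      _ = _ := by ring
  have hQy : |(Q:ℝ) * y + D'| * q ≤ a' * (8 * c * R ^ (k + 2)) := by
    have e : (Q:ℝ) * y + D' = A * e2 - A' * e1 := by rw [hQ, hD', he1, he2]; push_cast; ring
    have : |(Q:ℝ) * y + D'| ≤ |(A:ℝ)| * |e2| + |(A':ℝ)| * |e1| := by
      rw [e, ← abs_mul, ← abs_mul]; exact abs_sub _ _
    calc |(Q:ℝ) * y + D'| * q ≤ (|(A:ℝ)| * |e2| + |(A':ℝ)| * |e1|) * q := by gcongr
      _ = |(A:ℝ)| * (q * |e2|) + |(A':ℝ)| * (q * |e1|) := by ring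
      _ ≤ a' * (6 * c * R ^ (k+2)) + a' * (2 * c * R ^ (k+2)) := by gcongr
      _ = _ := by ring
  have hQθ2 : |(Q:ℝ) * θ + D| * (q * R ^ (2 * k)) ≤ b' * (8 * c * R ^ (k + 2)) := by
    refine le_trans ?_ hQθ
    gcongr
  have hQb : |(Q:ℝ)| ≤ 2 * q' / R ^ (L * k) := by
    rw [le_div_iff₀ hWpos]
    have : |(Q:ℝ)| ≤ |(A:ℝ)| * |(B':ℝ)| + |(A':ℝ)| * |(B:ℝ)| := by
      rw [hQ, ← abs_mul, ← abs_mul]; push_cast; exact abs_sub _ _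
    calc |(Q:ℝ)| * R ^ (L*k) ≤ (|(A:ℝ)| * |(B':ℝ)| + |(A':ℝ)| * |(B:ℝ)|) * R ^ (L*k) := by gcongr
      _ = |(A:ℝ)| * (|(B':ℝ)| * R ^ (L*k)) + |(A':ℝ)| * (|(B:ℝ)| * R ^ (L*k)) := by ring
      _ ≤ a' * b' + a' * b' := by gcongr
      _ = _ := by rw [h'.hab]; ring
  have hX2 : R ^ (2 * k) = R ^ k * R ^ k := by rw [two_mul, pow_add]
  have hk1 : 1 ≤ R ^ k := one_le_pow₀ hR
  by_cases hQ0 : Q = 0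
  · -- parallel case
    have hD0 : D = 0 := by
      rw [← Int.abs_lt_one_iff]
      rw [hQ0] at hQθ2
      simp only [Int.cast_zero, zero_mul, zero_add] at hQθ2
      have h1 : b' * (8 * c * R ^ (k + 2)) ≤ q' * (8 * R ^ (k+2)) := by
        have : b' ≤ q' := by
          rw [← h'.hab]; nlinarith [h'.ha]
        have : c * R ^ (k+2) ≤ R ^ (k+2) := by nlinarith
        calc b' * (8 * c * R ^ (k + 2)) = b' * (8 * (c * R ^ (k+2))) := by ring
          _ ≤ _ := by gcongr
      have h2 : q' * (8 * R ^ (k+2)) ≤ q * (8 * R ^ (L + 3) * R ^ k) := by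
        calc q' * (8 * R ^ (k+2)) ≤ (R ^ (L+1) * q) * (8 * R ^ (k+2)) := by gcongr
          _ = _ := by ring
      have h3 : q * (8 * R ^ (L + 3) * R ^ k) < q * (R ^ k * R ^ k) := by
        have : 0 < R ^ (L+3) := by positivity
        gcongr
        linarith
      have h4 : |(D:ℝ)| * (q * R ^ (2*k)) < 1 * (q * R ^ (2*k)) := by
        rw [one_mul]; nth_rewrite 2 [hX2]; linarith
      have h5 := lt_of_mul_lt_mul_right h4 (by positivity)
      exact_mod_cast h5
    have e : (B':ℝ) * e1 - B * e2 = 0 := by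
      have : (Q:ℝ) * θ + D = B' * e1 - B * e2 := by rw [hQ, hD, he1, he2]; push_cast; ring
      rw [← this, hQ0, hD0]; simp
    set e3 : ℝ := A' * θ + B' * y' + C' with he3
    have e' : (B:ℝ) * B' * (y - y') = B' * e1 - B * e3 := by
      have : e2 = e3 + B' * (y - y') := by rw [he2, he3]; ring
      rw [this] at e; linarith
    have hBp := h.Bpos
    have hBp' := h'.Bpos
    have h6 : |(B:ℝ)| * |(B':ℝ)| * |y - y'| ≤ |(B':ℝ)| * |e1| + |(B:ℝ)| * |e3| := by
      rw [← abs_mul, ← abs_mul, ← abs_mul, ← abs_mul, e']; exact abs_sub _ _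
    have h7 : |y - y'| ≤ |e1| / |(B:ℝ)| + |e3| / |(B':ℝ)| := by
      rw [div_add_div _ _ (by linarith) (by linarith), le_div_iff₀ (by positivity)]
      linarith
    have h8 : |e1| / |(B:ℝ)| ≤ l / R ^ (m + k + 1) / 2 := h.e_div hR hl hc
    have h8' : |e3| / |(B':ℝ)| ≤ l / R ^ (m + k + 1) / 2 := h'.e_div hR hl hc
    linarith
  · exfalso
    have hnat : ((Q.natAbs : ℕ) : ℝ) = |(Q:ℝ)| := by
      rw [Nat.cast_natAbs]; push_cast; rfl
    refine hmin Q.natAbs (Int.natAbs_pos.mpr hQ0) ?_ (by rw [hnat]; exact hQb) ?_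
    · rw [hnat]
      refine lt_of_le_of_lt hQb ?_
      rw [div_lt_iff₀ hWpos]
      have h1 : 2 * q' ≤ 2 * (R ^ (L+1) * q) := by linarith
      have h2 : R ^ (L+1) ≤ R ^ (L+3) := pow_le_pow_right₀ hR (by omega)
      have h3 : R ^ k ≤ R ^ (L*k) := pow_le_pow_right₀ hR (by nlinarith)
      nlinarith
    · rcases le_total 0 Q with hp | hn
      · refine ⟨-D, -D', ?_, ?_⟩
        · rw [hnat, abs_of_nonneg (by exact_mod_cast hp : (0:ℝ) ≤ Q)]; push_cast; rw [sub_neg_eq_add]; exact hQθ2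
        · rw [hnat, abs_of_nonneg (by exact_mod_cast hp : (0:ℝ) ≤ Q)]; push_cast; rw [sub_neg_eq_add]; exact hQy
      · have hn' : (Q:ℝ) ≤ 0 := by exact_mod_cast hn
        refine ⟨D, D', ?_, ?_⟩
        · rw [hnat, abs_of_nonpos hn', ← abs_neg]; convert hQθ2 using 3; ring
        · rw [hnat, abs_of_nonpos hn', ← abs_neg]; convert hQy using 3; ring
end

theorem dInt_le (x : ℝ) (n : ℤ) : dInt x ≤ |x - n| :=
  ciInf_le ⟨0, by rintro _ ⟨n, rfl⟩; exact abs_nonneg _⟩ n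

theorem dInt_eq (x : ℝ) : dInt x = |x - round x| :=
  le_antisymm (dInt_le x _) (le_ciInf fun n => round_le x n)

def Viol (s t θ c : ℝ) (q : ℕ) (y : ℝ) : Prop :=
  1 ≤ q ∧ ∃ p r : ℤ, (q:ℝ) ^ s * |q * θ - p| < c ∧ (q:ℝ) ^ t * |q * y - r| < c

theorem exists_viol {s t θ c y : ℝ} (hc : 0 < c) (h : y ∉ BadST s t θ) : ∃ q, Viol s t θ c q y := by
  by_contra! hcon
  apply h
  have : c ≤ ⨅ q : {q : ℕ // 0 < q},
      max ((q : ℝ) ^ s * dInt ((q : ℝ) * θ)) ((q : ℝ) ^ t * dInt ((q : ℝ) * y)) := by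
    have : Nonempty {q : ℕ // 0 < q} := ⟨⟨1, one_pos⟩⟩
    refine le_ciInf fun q => ?_
    by_contra! hlt
    rw [max_lt_iff, dInt_eq, dInt_eq] at hlt
    exact hcon q ⟨q.2, _, _, hlt⟩
  exact lt_of_lt_of_le hc this

theorem exists_line {s t : ℝ} (hst : s + t = 1) (q : ℕ) (hq : 1 ≤ q) (p r : ℤ) :
    ∃ A B C : ℤ, (A ≠ 0 ∨ B ≠ 0) ∧ |(A:ℝ)| ≤ (q:ℝ) ^ s ∧ |(B:ℝ)| ≤ (q:ℝ) ^ t ∧ A * p + B * r + C * q = 0 := by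
  have : NeZero q := ⟨by omega⟩
  set M := ⌊(q:ℝ) ^ s⌋₊
  set N := ⌊(q:ℝ) ^ t⌋₊
  have hM : (q:ℝ) ^ s < M + 1 := Nat.lt_floor_add_one _
  have hN : (q:ℝ) ^ t < N + 1 := Nat.lt_floor_add_one _
  have hM' : (M:ℝ) ≤ (q:ℝ) ^ s := Nat.floor_le (by positivity)
  have hN' : (N:ℝ) ≤ (q:ℝ) ^ t := Nat.floor_le (by positivity)
  have hq0 : (0:ℝ) < q := by exact_mod_cast hq
  have hcard : q < (M + 1) * (N + 1) := by
    have : (q:ℝ) < (M + 1) * (N + 1) := by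
      calc (q:ℝ) = (q:ℝ) ^ s * (q:ℝ) ^ t := by rw [← Real.rpow_add hq0, hst, Real.rpow_one]
        _ < (M + 1) * (N + 1) := by
          apply mul_lt_mul'' hM hN <;> positivity
    exact_mod_cast this
  obtain ⟨x, hx, z, hz, hxz, heq⟩ := Finset.exists_ne_map_eq_of_card_lt_of_maps_to
    (s := Finset.range (M+1) ×ˢ Finset.range (N+1)) (t := (Finset.univ : Finset (ZMod q)))
    (by simpa [ZMod.card] using hcard) (f := fun x => ((x.1 : ℤ) * p + (x.2 : ℤ) * r : ℤ)) (fun _ _ => by simp)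
  simp only [Finset.mem_product, Finset.mem_range] at hx hz
  have hd : (q:ℤ) ∣ ((x.1 : ℤ) * p + (x.2 : ℤ) * r) - ((z.1 : ℤ) * p + (z.2 : ℤ) * r) := by
    rw [← ZMod.intCast_zmod_eq_zero_iff_dvd] 
    rw [Int.cast_sub, sub_eq_zero]
    exact heq
  obtain ⟨C, hC⟩ := hd
  refine ⟨(x.1:ℤ) - z.1, (x.2:ℤ) - z.2, -C, ?_, ?_, ?_, ?_⟩
  · by_contra! hcon
    apply hxz
    ext <;> omega
  · refine le_trans ?_ hM'
    have : |(x.1:ℤ) - z.1| ≤ M := by rw [abs_le]; omega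
    exact_mod_cast this
  · refine le_trans ?_ hN'
    have : |(x.2:ℤ) - z.2| ≤ N := by rw [abs_le]; omega
    exact_mod_cast this
  · linarith

def ESet (s t θ c l R : ℝ) (L m k : ℕ) : Set ℝ :=
  {y | ∃ q : ℕ, (∀ n, Viol s t θ c n y → q ≤ n) ∧ ∃ A B C p r : ℤ,
    Dat θ c l R L m k y ((q:ℝ) ^ s) ((q:ℝ) ^ t) q A B C p r}

theorem mem_ESet {s t θ c0 c l R y : ℝ} {L : ℕ} (hs : 0 ≤ s) (ht : 0 ≤ t) (hst : s + t = 1)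
    (hθ : ∀ q : ℕ, 1 ≤ q → ∀ A C : ℤ, A ≠ 0 → |(A:ℝ)| ≤ (q:ℝ) ^ s → c0 / q ≤ |A * θ + C|)
    (hc : 0 < c) (hcc : c ≤ c0) (hcl : 4 * c * R ≤ l) (hl : 0 < l) (hR : 1 < R) (hL : 2 ≤ L)
    (hy : y ∉ BadST s t θ) : ∃ m k, y ∈ ESet s t θ c l R L m k := by
  classical
  have hex := exists_viol hc hy
  set q := Nat.find hex
  obtain ⟨hq, p, r, hu, hv⟩ := Nat.find_spec hex
  obtain ⟨A, B, C, h0, hA, hB, hline⟩ := exists_line hst q hq p r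
  have hq1 : (1:ℝ) ≤ q := by exact_mod_cast hq
  have hq0 : (0:ℝ) < q := by linarith
  have hline' : (A:ℝ) * p + B * r + C * q = 0 := by exact_mod_cast hline
  have hB0 : B ≠ 0 := by
    rintro rfl
    have hA0 : A ≠ 0 := by simpa using h0
    have h1 := hθ q hq A C hA0 hA
    rw [div_le_iff₀ hq0] at h1
    have h2 : |A * θ + C| * q = |(A:ℝ)| * |q * θ - p| := by
      rw [← abs_mul]
      calc |A * θ + C| * q = |A * θ + C| * |(q:ℝ)| := by rw [abs_of_pos hq0]
        _ = |(A * θ + C) * q| := (abs_mul _ _).symm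
        _ = _ := ?_
      congr 1
      push_cast at hline'
      linear_combination hline'
    have h3 : |(A:ℝ)| * |q * θ - p| ≤ (q:ℝ) ^ s * |q * θ - p| := by gcongr
    linarith
  have hBp : 1 ≤ |(B:ℝ)| := by exact_mod_cast Int.one_le_abs hB0
  have ha1 : 1 ≤ (q:ℝ) ^ s := Real.one_le_rpow hq1 hs
  have hb1 : 1 ≤ (q:ℝ) ^ t := Real.one_le_rpow hq1 ht
  have hab : (q:ℝ) ^ s * (q:ℝ) ^ t = q := by rw [← Real.rpow_add hq0, hst, Real.rpow_one]
  obtain ⟨k, hk1, hk2⟩ := exists_nat_pow_near (x := (q:ℝ) ^ t / |(B:ℝ)|) (y := R ^ L)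
    (by rw [le_div_iff₀ (by linarith)]; linarith) (one_lt_pow₀ hR (by omega))
  rw [← pow_mul] at hk1 hk2
  rw [le_div_iff₀ (by linarith)] at hk1
  rw [div_lt_iff₀ (by linarith)] at hk2
  have hRk : R ^ k ≤ q := by
    have h1 : R ^ k ≤ R ^ (L * k) := pow_le_pow_right₀ hR.le (by nlinarith)
    have h2 : R ^ (L * k) ≤ R ^ (L*k) * |(B:ℝ)| := le_mul_of_one_le_right (by positivity) hBp
    have h3 : (q:ℝ) ^ t ≤ q := by
      nth_rewrite 2 [← hab]; exact le_mul_of_one_le_left (by positivity) ha1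
    linarith
  have hden : 0 < 4 * c * R ^ (k+1) := by positivity
  obtain ⟨m, hm1, hm2⟩ := exists_nat_pow_near (x := l * (q * |(B:ℝ)|) / (4 * c * R ^ (k+1))) (y := R)
    (by
      rw [le_div_iff₀ hden, one_mul]
      calc 4 * c * R ^ (k+1) = (4 * c * R) * R ^ k := by ring
        _ ≤ l * (q * 1) := by rw [mul_one]; gcongr
        _ ≤ _ := by gcongr) hR
  rw [le_div_iff₀ hden] at hm1
  rw [div_lt_iff₀ hden] at hm2
  refine ⟨m, k, q, fun n hn => Nat.find_min' hex hn, A, B, C, p, r, ?_⟩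
  exact ⟨hq1, ha1, hb1, hab, hu, hv, hA, hB0, hline', hk1, hk2,
    (le_of_eq (by ring)).trans hm1, hm2.trans_le (le_of_eq (by ring))⟩

theorem ESet_pair {s t θ c l R : ℝ} {L m k : ℕ} (hs : 0 ≤ s) (ht : 0 < t) (hst : s + t = 1)
    (hc : 0 < c) (hc1 : c ≤ 1) (hcs : 8 * c * R ^ (2 * L + 7) < 1) (hl : 0 < l) (hR : 16 < R) (hL : 2 ≤ L)
    (hLt : 2 ≤ L * t) {y y' : ℝ} (hy : y ∈ ESet s t θ c l R L m k) (hy' : y' ∈ ESet s t θ c l R L m k)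
    (hyy : |y - y'| ≤ l / R ^ m) : |y - y'| ≤ l / R ^ (m + k + 1) := by
  obtain ⟨q, hqm, A, B, C, p, r, h⟩ := hy
  obtain ⟨q', hqm', A', B', C', p', r', h'⟩ := hy'
  wlog hqq : q ≤ q' generalizing y y' q q' A B C p r A' B' C' p' r'
  · rw [abs_sub_comm] at hyy ⊢
    exact this hyy q' hqm' A' B' C' p' r' h' q hqm A B C p r h (by omega)
  have hqq' : (q:ℝ) ≤ q' := by exact_mod_cast hqq
  have hR1 : 1 ≤ R := by linarith
  have hq1 := h.hq
  have hq1' := h'.hq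
  have haa : (q:ℝ) ^ s ≤ (q':ℝ) ^ s := Real.rpow_le_rpow (by linarith) hqq' hs
  have hbb : (q:ℝ) ^ t ≤ (q':ℝ) ^ t := Real.rpow_le_rpow (by linarith) hqq' ht.le
  by_cases hk : k ≤ L + 4
  · refine pair_small h h' ⟨q', by simp⟩ hR1 hl haa hbb hqq' hc hyy ?_
    refine lt_of_le_of_lt ?_ hcs
    rw [mul_assoc, ← pow_add]
    exact mul_le_mul_of_nonneg_left (pow_le_pow_right₀ hR1 (by omega)) (by positivity)
  · have hkL : 16 * R ^ (L + 3) < R ^ k := by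
      calc 16 * R ^ (L+3) < R * R ^ (L+3) := by gcongr
        _ = R ^ (L + 4) := by ring
        _ ≤ R ^ k := pow_le_pow_right₀ hR1 (by omega)
    refine pair_large h h' hR1 hl haa hbb hc hc1 hyy hL hkL ?_
    rintro n hn1 hnq hnb ⟨P, S, hP, hS⟩
    have hrat := h.ratio h' hR1 hl hbb
    have hab' := h'.hab
    have ha1' := h'.ha
    have hb1' := h'.hb
    have hnR : (1:ℝ) ≤ n := by exact_mod_cast hn1
    have hs1 : s ≤ 1 := by linarith
    have ht1 : t ≤ 1 := by linarith
    have h2s : (2:ℝ) ^ s ≤ 2 := by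
      calc (2:ℝ) ^ s ≤ 2 ^ (1:ℝ) := Real.rpow_le_rpow_of_exponent_le (by norm_num) hs1
        _ = 2 := by norm_num
    have h2t : (2:ℝ) ^ t ≤ 2 := by
      calc (2:ℝ) ^ t ≤ 2 ^ (1:ℝ) := Real.rpow_le_rpow_of_exponent_le (by norm_num) ht1
        _ = 2 := by norm_num
    have hWpos : 0 < R ^ (L * k) := by positivity
    have hW1 : 1 ≤ R ^ (L * k) := one_le_pow₀ hR1
    have hns : (n:ℝ) ^ s ≤ 2 * (q':ℝ) ^ s := by
      calc (n:ℝ) ^ s ≤ (2 * q') ^ s := by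
            apply Real.rpow_le_rpow (by linarith) _ hs
            exact hnb.trans (div_le_self (by linarith) hW1)
        _ = 2 ^ s * (q':ℝ) ^ s := Real.mul_rpow (by norm_num) (by linarith)
        _ ≤ _ := by gcongr
    have hWt : R ^ (2 * k) ≤ (R ^ (L * k)) ^ t := by
      have e1 : (R ^ (L * k)) ^ t = (R ^ k) ^ ((L:ℝ) * t) := by
        rw [mul_comm L k, pow_mul, ← Real.rpow_natCast (R ^ k) L, ← Real.rpow_mul (by positivity)]
      rw [e1]
      calc R ^ (2 * k) = (R ^ k) ^ (2:ℝ) := by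
            rw [mul_comm, pow_mul]; norm_cast
        _ ≤ _ := Real.rpow_le_rpow_of_exponent_le (one_le_pow₀ hR1) hLt
    have hXpos : 0 < R ^ (2 * k) := by positivity
    have hnt : (n:ℝ) ^ t * R ^ (2 * k) ≤ 2 * (q':ℝ) ^ t := by
      calc (n:ℝ) ^ t * R ^ (2 * k) ≤ (n:ℝ) ^ t * (R ^ (L * k)) ^ t := by gcongr
        _ = (n * R ^ (L * k)) ^ t := (Real.mul_rpow (by linarith) hWpos.le).symm
        _ ≤ (2 * q') ^ t := by
            apply Real.rpow_le_rpow (by positivity) _ ht.le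
            rwa [le_div_iff₀ hWpos] at hnb
        _ = 2 ^ t * (q':ℝ) ^ t := Real.mul_rpow (by norm_num) (by linarith)
        _ ≤ _ := by gcongr
    have key : 2 * (q':ℝ) * (8 * c * R ^ (k+2)) < c * (q * R ^ (2 * k)) := by
      calc 2 * (q':ℝ) * (8 * c * R ^ (k+2)) ≤ 2 * (R ^ (L+1) * q) * (8 * c * R ^ (k+2)) := by gcongr
        _ = c * (q * (16 * R ^ (L + 3) * R ^ k)) := by ring
        _ < c * (q * (R ^ k * R ^ k)) := by gcongr
        _ = _ := by ring
    have hqX : 0 < (q:ℝ) * R ^ (2 * k) := by positivity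
    have hviol : Viol s t θ c n y := by
      refine ⟨hn1, P, S, ?_, ?_⟩
      · refine lt_of_mul_lt_mul_right (a := (q:ℝ) * R ^ (2 * k)) ?_ hqX.le
        refine lt_of_le_of_lt ?_ key
        calc (n:ℝ) ^ s * |n * θ - P| * (q * R ^ (2*k)) = (n:ℝ) ^ s * (|n * θ - P| * (q * R ^ (2*k))) := by ring
          _ ≤ (2 * (q':ℝ) ^ s) * ((q':ℝ) ^ t * (8 * c * R ^ (k+2))) := by gcongr
          _ = 2 * ((q':ℝ) ^ s * (q':ℝ) ^ t) * (8 * c * R ^ (k+2)) := by ring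
          _ = _ := by rw [hab']
      · refine lt_of_mul_lt_mul_right (a := (q:ℝ) * R ^ (2 * k)) ?_ hqX.le
        refine lt_of_le_of_lt ?_ key
        calc (n:ℝ) ^ t * |n * y - S| * (q * R ^ (2*k)) = ((n:ℝ) ^ t * R ^ (2 * k)) * (|n * y - S| * q) := by ring
          _ ≤ (2 * (q':ℝ) ^ t) * ((q':ℝ) ^ s * (8 * c * R ^ (k+2))) := by gcongr
          _ = 2 * ((q':ℝ) ^ s * (q':ℝ) ^ t) * (8 * c * R ^ (k+2)) := by ring
          _ = _ := by rw [hab']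
    have := hqm n hviol
    have : n < q := by exact_mod_cast hnq
    omega

theorem bad_cover {s t θ c0 : ℝ} (hs : 0 ≤ s) (ht : 0 < t) (hst : s + t = 1) (hc0 : 0 < c0)
    (hθ : ∀ q : ℕ, 1 ≤ q → ∀ A C : ℤ, A ≠ 0 → |(A:ℝ)| ≤ (q:ℝ) ^ s → c0 / q ≤ |A * θ + C|)
    {R l : ℝ} (hR : 16 < R) (hl : 0 < l) :
    ∃ E : ℕ → ℕ → Set ℝ, (∀ y, y ∉ BadST s t θ → ∃ m k, y ∈ E m k) ∧
      ∀ m k, ∀ y ∈ E m k, ∀ y' ∈ E m k, |y - y'| ≤ l / R ^ m → |y - y'| ≤ l / R ^ (m + k + 1) := by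
  obtain ⟨L0, hL0⟩ := exists_nat_ge (2 / t)
  set L := L0 + 2
  have hLt : 2 ≤ (L:ℝ) * t := by
    rw [div_le_iff₀ ht] at hL0
    simp only [L]; push_cast; nlinarith
  have hRp : 0 < R := by linarith
  set c := min (min c0 1) (min (l / (4 * R)) (1 / (16 * R ^ (2 * L + 7))))
  have hc : 0 < c := by simp only [c, lt_min_iff]; refine ⟨⟨hc0, one_pos⟩, ?_, ?_⟩ <;> positivity
  have h1 : c ≤ c0 := (min_le_left _ _).trans (min_le_left _ _)
  have h2 : c ≤ 1 := (min_le_left _ _).trans (min_le_right _ _)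
  have h3 : c ≤ l / (4 * R) := (min_le_right _ _).trans (min_le_left _ _)
  have h4 : c ≤ 1 / (16 * R ^ (2 * L + 7)) := (min_le_right _ _).trans (min_le_right _ _)
  rw [le_div_iff₀ (by positivity)] at h3 h4
  refine ⟨ESet s t θ c l R L, fun y hy => mem_ESet hs ht.le hst hθ hc h1 (by linarith) hl (by linarith) (by omega) hy, ?_⟩
  intro m k y hy y' hy' hyy
  exact ESet_pair hs ht hst hc h2 (by linarith) hl hR (by omega) hLt hy hy' hyy

section cantor
variable (R N : ℕ) (e : ℕ → ℕ → ℕ → ℕ)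

/-- index of the `u`-th node of level `n`. -/
def cidx : ℕ → ℕ → ℕ
  | 0, _ => 0
  | n+1, u => R * cidx n (u / N) + e n (cidx n (u / N)) (u % N)

variable {R N e} {Good : ℕ → ℕ → Prop} 

theorem cidx_good (hN : 0 < N) (h0 : Good 0 0)
    (he : ∀ n j, Good n j → ∀ d < N, Good (n+1) (R * j + e n j d)) (n u : ℕ) : Good n (cidx R N e n u) := by
  induction n generalizing u with
  | zero => exact h0
  | succ n ih => exact he n _ (ih _) _ (Nat.mod_lt _ hN)

theorem cidx_inj (hN : 0 < N) (h0 : Good 0 0)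
    (he : ∀ n j, Good n j → ∀ d < N, Good (n+1) (R * j + e n j d))
    (heR : ∀ n j, Good n j → ∀ d < N, e n j d < R)
    (hinj : ∀ n j, Good n j → ∀ d < N, ∀ d' < N, e n j d = e n j d' → d = d')
    (n u v : ℕ) (hu : u < N ^ n) (hv : v < N ^ n) (h : cidx R N e n u = cidx R N e n v) : u = v := by
  induction n generalizing u v with
  | zero => simp at hu hv; omega
  | succ n ih =>
    simp only [cidx] at h
    have gu := cidx_good hN h0 he n (u / N)
    have gv := cidx_good hN h0 he n (v / N)
    have eu := heR n _ gu _ (Nat.mod_lt u hN)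
    have ev := heR n _ gv _ (Nat.mod_lt v hN)
    have hRp : 0 < R := by omega
    have h1 : cidx R N e n (u / N) = cidx R N e n (v / N) := by
      have := congrArg (· / R) h
      simpa [Nat.mul_add_div hRp, Nat.div_eq_of_lt eu, Nat.div_eq_of_lt ev] using this
    have h2 : u / N = v / N := ih _ _ (Nat.div_lt_of_lt_mul (by rw [pow_succ] at hu; linarith))
      (Nat.div_lt_of_lt_mul (by rw [pow_succ] at hv; linarith)) h1
    rw [h1] at h
    have h3 := hinj n _ gv _ (Nat.mod_lt u hN) _ (Nat.mod_lt v hN) (by omega)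
    rw [← Nat.div_add_mod u N, ← Nat.div_add_mod v N, h2, h3]

end cantor

open MeasureTheory in
theorem cantor_dim {R N : ℕ} (hN : 2 ≤ N) (hR : 2 ≤ R) {Good : ℕ → ℕ → Prop} (h0 : Good 0 0)
    (hG : ∀ n j, Good n j → ∃ f : ℕ → ℕ, (∀ d < N, f d < R ∧ Good (n+1) (R * j + f d)) ∧
      ∀ d < N, ∀ d' < N, f d = f d' → d = d')
    {x0 l : ℝ} (hl : 0 < l) {d : NNReal} (hd : 0 < d) (hdN : (R:ℝ) ^ (d:ℝ) ≤ N) {K : Set ℝ}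
    (hK : ∀ y, (∀ n, ∃ j, Good n j ∧ x0 + l * (j / R ^ n) ≤ y ∧ y ≤ x0 + l * ((j + 1) / R ^ n)) → y ∈ K) :
    (d : ENNReal) ≤ dimH K := by
  classical
  have hG' : ∀ n j, ∃ f : ℕ → ℕ, Good n j → ((∀ d < N, f d < R ∧ Good (n+1) (R * j + f d)) ∧
      ∀ d < N, ∀ d' < N, f d = f d' → d = d') := by
    intro n j
    by_cases h : Good n j
    · obtain ⟨f, hf⟩ := hG n j h; exact ⟨f, fun _ => hf⟩
    · exact ⟨id, fun h' => absurd h' h⟩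
  choose e he using hG'
  have hN0 : 0 < N := by omega
  have hR0 : (0:ℝ) < R := by exact_mod_cast (by omega : 0 < R)
  have hNR : (0:ℝ) < N := by exact_mod_cast hN0
  have he1 : ∀ n j, Good n j → ∀ d < N, Good (n+1) (R * j + e n j d) := fun n j h d hd => ((he n j h).1 d hd).2
  have he2 : ∀ n j, Good n j → ∀ d < N, e n j d < R := fun n j h d hd => ((he n j h).1 d hd).1
  have he3 : ∀ n j, Good n j → ∀ d < N, ∀ d' < N, e n j d = e n j d' → d = d' := fun n j h => (he n j h).2
  let U : ℕ → ℝ → ℕ := fun n x => ⌊(N:ℝ) ^ n * x⌋₊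
  have hU : ∀ n x, U (n+1) x / N = U n x := by
    intro n x
    simp only [U]
    rw [← Nat.floor_div_natCast]
    congr 1
    rw [pow_succ]
    field_simp
  let J : ℕ → ℝ → ℕ := fun n x => cidx R N e n (U n x)
  have hJgood : ∀ n x, Good n (J n x) := fun n x => cidx_good hN0 h0 he1 n _
  have hJs : ∀ n x, ∃ r < R, J (n+1) x = R * J n x + r := by
    intro n x
    refine ⟨e n (J n x) (U (n+1) x % N), he2 _ _ (hJgood n x) _ (Nat.mod_lt _ hN0), ?_⟩
    simp only [J, cidx, hU]
  let g : ℕ → ℝ → ℝ := fun n x => x0 + l * (J n x / R ^ n)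
  let h : ℕ → ℝ → ℝ := fun n x => x0 + l * ((J n x + 1) / R ^ n)
  have hgmono : ∀ x, Monotone (fun n => g n x) := by
    intro x
    refine monotone_nat_of_le_succ fun n => ?_
    obtain ⟨r, hr, hJ⟩ := hJs n x
    simp only [g, hJ]
    refine add_le_add_right (mul_le_mul_of_nonneg_left ?_ hl.le) x0
    rw [div_le_div_iff₀ (by positivity) (by positivity)]
    push_cast
    rw [pow_succ]
    have : (0:ℝ) ≤ r := by positivity
    have : (0:ℝ) ≤ r * R ^ n := by positivity
    nlinarith
  have hhanti : ∀ x, Antitone (fun n => h n x) := by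
    intro x
    refine antitone_nat_of_succ_le fun n => ?_
    obtain ⟨r, hr, hJ⟩ := hJs n x
    simp only [h, hJ]
    refine add_le_add_right (mul_le_mul_of_nonneg_left ?_ hl.le) x0
    rw [div_le_div_iff₀ (by positivity) (by positivity)]
    push_cast
    rw [pow_succ]
    have : (r:ℝ) + 1 ≤ R := by exact_mod_cast hr
    have : ((r:ℝ) + 1) * R ^ n ≤ R * R ^ n := by gcongr
    nlinarith
  have hgh : ∀ n x, g n x ≤ h n x := by
    intro n x; simp only [g, h]; gcongr; linarith
  have hgh' : ∀ m n x, g m x ≤ h n x := by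
    intro m n x
    exact (hgmono x (le_max_left m n)).trans ((hgh _ x).trans (hhanti x (le_max_right m n)))
  have hbdd : ∀ x, BddAbove (Set.range fun n => g n x) := fun x => ⟨h 0 x, by rintro _ ⟨n, rfl⟩; exact hgh' n 0 x⟩
  let G : ℝ → ℝ := fun x => ⨆ n, g n x
  have hG1 : ∀ n x, g n x ≤ G x := fun n x => le_ciSup (hbdd x) n
  have hG2 : ∀ n x, G x ≤ h n x := fun n x => ciSup_le fun m => hgh' m n x
  have hgmeas : ∀ n, Measurable (g n) := by
    intro n
    have hJm : Measurable (fun x => ((J n x : ℕ) : ℝ)) := by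
      have : (fun x => ((J n x : ℕ) : ℝ)) = (fun u : ℕ => ((cidx R N e n u : ℕ) : ℝ)) ∘ (fun x : ℝ => ⌊(N:ℝ) ^ n * x⌋₊) := rfl
      rw [this]
      exact (measurable_from_nat).comp (Nat.measurable_floor.comp (measurable_const.mul measurable_id))
    exact measurable_const.add (measurable_const.mul (hJm.div_const _))
  have hGmeas : Measurable G := by
    refine measurable_of_tendsto_metrizable hgmeas ?_
    rw [tendsto_pi_nhds]
    intro x
    exact tendsto_atTop_ciSup (hgmono x) (hbdd x)
  have hGK : ∀ x, G x ∈ K := fun x => hK _ fun n => ⟨J n x, hJgood n x, hG1 n x, hG2 n x⟩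
  let μ0 : Measure ℝ := volume.restrict (Set.Ico 0 1)
  let μ : Measure ℝ := Measure.map G μ0
  have hμK : 1 ≤ μ K := by
    refine le_trans ?_ (Measure.le_map_apply hGmeas.aemeasurable K)
    have : G ⁻¹' K = Set.univ := by ext x; simp [hGK]
    rw [this]; simp [μ0]
  -- basic measure bound
  have hbound : ∀ n (s : Set ℝ), Metric.ediam s ≤ ENNReal.ofReal (l / R ^ n) → μ s ≤ 3 * ENNReal.ofReal ((N:ℝ) ^ n)⁻¹ := by
    intro n s hs
    refine (measure_mono subset_closure).trans ?_
    rw [← Metric.ediam_closure] at hs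
    have hcl : MeasurableSet (closure s) := isClosed_closure.measurableSet
    generalize closure s = s at hs hcl
    rw [Measure.map_apply hGmeas hcl, Measure.restrict_apply (hGmeas hcl)]
    let S : Set ℕ := {u | ∃ x ∈ G ⁻¹' s ∩ Set.Ico 0 1, U n x = u}
    have hUlt : ∀ x ∈ Set.Ico (0:ℝ) 1, U n x < N ^ n := by
      intro x hx
      simp only [U]
      rw [Nat.floor_lt (by have := hx.1; positivity)]
      push_cast
      have := hx.2
      have : 0 < (N:ℝ) ^ n := by positivity
      nlinarith
    have hSfin : S.Finite := (Set.finite_lt_nat (N ^ n)).subset (by rintro u ⟨x, hx, rfl⟩; exact hUlt x hx.2)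
    have hScard : hSfin.toFinset.card ≤ 3 := by
      have himg : (hSfin.toFinset.image (cidx R N e n)).card = hSfin.toFinset.card := by
        apply Finset.card_image_of_injOn
        intro u hu v hv huv
        simp only [Set.Finite.coe_toFinset] at hu hv
        obtain ⟨x, hx, rfl⟩ := hu
        obtain ⟨x', hx', rfl⟩ := hv
        exact cidx_inj hN0 h0 he1 he2 he3 n _ _ (hUlt _ hx.2) (hUlt _ hx'.2) huv
      rw [← himg]
      rcases (hSfin.toFinset.image (cidx R N e n)).eq_empty_or_nonempty with hemp | hne
      · rw [hemp]; simp
      · set T := hSfin.toFinset.image (cidx R N e n)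
        have hsub : T ⊆ Finset.Icc (T.min' hne) (T.min' hne + 2) := by
          intro j hj
          have hmin := T.min'_mem hne
          have hle := T.min'_le j hj
          generalize T.min' hne = j' at *
          simp only [T, Finset.mem_image, Set.Finite.mem_toFinset] at hj hmin
          obtain ⟨_, ⟨x, hx, rfl⟩, rfl⟩ := hj
          obtain ⟨_, ⟨x', hx', rfl⟩, rfl⟩ := hmin
          rw [Finset.mem_Icc]
          refine ⟨hle, ?_⟩
          have hdist : edist (G x) (G x') ≤ ENNReal.ofReal (l / R ^ n) :=
            (Metric.edist_le_ediam_of_mem (show G x ∈ s from hx.1) (show G x' ∈ s from hx'.1)).trans hs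
          rw [edist_dist, ENNReal.ofReal_le_ofReal_iff (by positivity), Real.dist_eq] at hdist
          have h1 := hG1 n x
          have h2 := hG2 n x'
          have h3 := (abs_le.mp hdist).2
          have h4 : l / R ^ n * (J n x : ℝ) ≤ l / R ^ n * ((J n x' : ℝ) + 2) := by
            have e1 : g n x = x0 + l / R ^ n * (J n x : ℝ) := by simp only [g]; ring
            have e2 : h n x' = x0 + l / R ^ n * (J n x' + 1 : ℝ) := by simp only [h]; ring
            rw [e1] at h1
            rw [e2] at h2
            linarith
          have h5 := le_of_mul_le_mul_left h4 (by positivity)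
          exact_mod_cast h5
        calc T.card ≤ _ := Finset.card_le_card hsub
          _ = 3 := by simp; omega
    have hcov : G ⁻¹' s ∩ Set.Ico 0 1 ⊆ ⋃ u ∈ hSfin.toFinset, Set.Icc ((u:ℝ) / N ^ n) ((u + 1) / N ^ n) := by
      intro x hx
      simp only [Set.mem_iUnion]
      refine ⟨U n x, by simp only [Set.Finite.mem_toFinset]; exact ⟨x, hx, rfl⟩, ?_⟩
      have hx0 : 0 ≤ (N:ℝ) ^ n * x := by have := hx.2.1; positivity
      constructor
      · rw [div_le_iff₀ (by positivity), mul_comm]; exact Nat.floor_le hx0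
      · rw [le_div_iff₀ (by positivity), mul_comm]; exact (Nat.lt_floor_add_one _).le
    refine (measure_mono hcov).trans ((measure_biUnion_finset_le _ _).trans ?_)
    have : ∀ u ∈ hSfin.toFinset, volume (Set.Icc ((u:ℝ) / N ^ n) ((u + 1) / N ^ n)) ≤ ENNReal.ofReal ((N:ℝ) ^ n)⁻¹ := by
      intro u _
      rw [Real.volume_Icc]
      apply le_of_eq; congr 1; ring
    refine (Finset.sum_le_card_nsmul _ _ _ this).trans ?_
    rw [nsmul_eq_mul]
    gcongr
    exact_mod_cast hScard
  -- Frostman estimate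
  let Cst : ℝ := 3 * (R / l) ^ (d:ℝ)
  have hCpos : 0 < Cst := by positivity
  have hd0 : (0:ℝ) < d := by exact_mod_cast hd
  have hfro : ∀ s : Set ℝ, Metric.ediam s ≤ ENNReal.ofReal l → (ENNReal.ofReal Cst⁻¹ • μ) s ≤ Metric.ediam s ^ (d:ℝ) := by
    intro s hs
    have hfin : Metric.ediam s ≠ ⊤ := ne_top_of_le_ne_top ENNReal.ofReal_ne_top hs
    obtain ⟨δ, hδ0, hδ⟩ : ∃ δ : ℝ, 0 ≤ δ ∧ Metric.ediam s = ENNReal.ofReal δ :=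
      ⟨_, ENNReal.toReal_nonneg, (ENNReal.ofReal_toReal hfin).symm⟩
    rw [hδ] at hs ⊢
    rw [ENNReal.ofReal_le_ofReal_iff hl.le] at hs
    rw [ENNReal.ofReal_rpow_of_nonneg hδ0 hd0.le, Measure.smul_apply, smul_eq_mul]
    rcases hδ0.eq_or_lt with hz | hpos
    · have : μ s = 0 := by
        have hle : ∀ n : ℕ, μ s ≤ 3 * ENNReal.ofReal ((N:ℝ) ^ n)⁻¹ := by
          intro n
          apply hbound
          rw [hδ, ← hz]; simp
        have hlim : Filter.Tendsto (fun n : ℕ => 3 * ENNReal.ofReal ((N:ℝ) ^ n)⁻¹) Filter.atTop (nhds (3 * ENNReal.ofReal 0)) := by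
          apply ENNReal.Tendsto.const_mul _ (Or.inr (by norm_num))
          apply ENNReal.tendsto_ofReal
          apply Filter.Tendsto.inv_tendsto_atTop
          exact tendsto_pow_atTop_atTop_of_one_lt (by exact_mod_cast (by omega : 1 < N))
        have := ge_of_tendsto' hlim hle
        simpa using this
      rw [this]; simp
    · obtain ⟨n, hn1, hn2⟩ := exists_nat_pow_near (x := l / δ) (y := (R:ℝ)) (by rw [le_div_iff₀ hpos]; linarith)
        (by exact_mod_cast (by omega : 1 < R))
      rw [le_div_iff₀ hpos] at hn1
      rw [div_lt_iff₀ hpos] at hn2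
      have h1 := hbound n s (by
        rw [hδ]; apply ENNReal.ofReal_le_ofReal
        rw [le_div_iff₀ (by positivity)]; linarith)
      have h2 : ((N:ℝ) ^ n)⁻¹ ≤ (R / l) ^ (d:ℝ) * δ ^ (d:ℝ) := by
        rw [inv_le_iff_one_le_mul₀ (by positivity), ← Real.mul_rpow (by positivity) hδ0]
        calc (1:ℝ) = 1 ^ (d:ℝ) := by simp
          _ ≤ (R / l * δ * R ^ n) ^ (d:ℝ) := by
            apply Real.rpow_le_rpow zero_le_one _ hd0.le
            rw [div_mul_eq_mul_div, div_mul_eq_mul_div, le_div_iff₀ hl]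
            rw [pow_succ] at hn2; linarith
          _ = (R / l * δ) ^ (d:ℝ) * (R ^ n) ^ (d:ℝ) := Real.mul_rpow (by positivity) (by positivity)
          _ = (R / l * δ) ^ (d:ℝ) * (R ^ (d:ℝ)) ^ n := by
            congr 1
            rw [← Real.rpow_natCast, ← Real.rpow_natCast, ← Real.rpow_mul hR0.le, ← Real.rpow_mul hR0.le, mul_comm]
          _ ≤ (R / l * δ) ^ (d:ℝ) * N ^ n := by gcongr
      calc ENNReal.ofReal Cst⁻¹ * μ s ≤ ENNReal.ofReal Cst⁻¹ * (3 * ENNReal.ofReal ((N:ℝ) ^ n)⁻¹) := by gcongr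
        _ = ENNReal.ofReal (Cst⁻¹ * (3 * ((N:ℝ) ^ n)⁻¹)) := by
          rw [ENNReal.ofReal_mul (by positivity), ENNReal.ofReal_mul (by norm_num)]; simp
        _ ≤ ENNReal.ofReal (δ ^ (d:ℝ)) := by
          apply ENNReal.ofReal_le_ofReal
          rw [inv_mul_le_iff₀ hCpos]
          simp only [Cst]
          linarith
  have hle := Measure.le_hausdorffMeasure (d:ℝ) (ENNReal.ofReal Cst⁻¹ • μ) (ENNReal.ofReal l) (by simpa using hl) hfro
  apply le_dimH_of_hausdorffMeasure_ne_zero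
  have := hle K
  rw [Measure.smul_apply, smul_eq_mul] at this
  intro hz
  rw [hz, nonpos_iff_eq_zero, mul_eq_zero] at this
  rcases this with h | h
  · simp at h; linarith
  · rw [h] at hμK; simp at hμK

theorem card_le_three (T : Finset ℕ) (h : ∀ a ∈ T, ∀ b ∈ T, a ≤ b + 2) : T.card ≤ 3 := by
  rcases T.eq_empty_or_nonempty with rfl | hne
  · simp
  · have hsub : T ⊆ Finset.Icc (T.min' hne) (T.min' hne + 2) := by
      intro j hj
      rw [Finset.mem_Icc]
      exact ⟨T.min'_le j hj, h _ hj _ (T.min'_mem hne)⟩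
    calc T.card ≤ _ := Finset.card_le_card hsub
      _ = 3 := by simp; omega

theorem sum_range_mul' {M : Type*} [AddCommMonoid M] (f : ℕ → M) (a b : ℕ) :
    ∑ v ∈ Finset.range (a * b), f v = ∑ r ∈ Finset.range a, ∑ u ∈ Finset.range b, f (r * b + u) := by
  induction a with
  | zero => simp
  | succ a ih => rw [Finset.sum_range_succ, ← ih, Nat.succ_mul, Finset.sum_range_add]

section pot
variable (R γ : ℕ) (x0 l : ℝ) (E : ℕ → ℕ → ℕ → Set ℝ)

/-- rules are indexed by `(i, k, m)` -/
def lo (ρ : ℕ × ℕ × ℕ) : ℕ := (ρ.1 + 1) * ρ.2.2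
def hi (ρ : ℕ × ℕ × ℕ) : ℕ := (ρ.1 + 1) * (ρ.2.2 + ρ.2.1 + 1)

def hit (ρ : ℕ × ℕ × ℕ) (j : ℕ) : Prop :=
  ∃ y ∈ E ρ.1 ρ.2.2 ρ.2.1, x0 + l * (j / R ^ hi ρ) ≤ y ∧ y ≤ x0 + l * ((j + 1) / R ^ hi ρ)

open Classical in
noncomputable def cnt (ρ : ℕ × ℕ × ℕ) (n j : ℕ) : ENNReal :=
  ∑ u ∈ Finset.range (R ^ (hi ρ - n)), if hit R x0 l E ρ (j * R ^ (hi ρ - n) + u) then 1 else 0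

noncomputable def term (ρ : ℕ × ℕ × ℕ) (n j : ℕ) : ENNReal :=
  if lo ρ < n ∧ n ≤ hi ρ then cnt R x0 l E ρ n j * (γ:ENNReal)⁻¹ ^ (hi ρ - n) else 0

noncomputable def pot (n j : ℕ) : ENNReal := ∑' ρ, term R γ x0 l E ρ n j

noncomputable def newt (ρ : ℕ × ℕ × ℕ) (n : ℕ) : ENNReal :=
  if lo ρ = n then 3 * (γ:ENNReal)⁻¹ ^ (hi ρ - n) else 0

variable {R γ x0 l E}

theorem lo_lt_hi (ρ : ℕ × ℕ × ℕ) : lo ρ < hi ρ := by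
  unfold lo hi; nlinarith [Nat.zero_le (ρ.1 * ρ.2.1), Nat.zero_le ρ.2.1, Nat.zero_le ρ.1]

theorem cnt_sum (ρ : ℕ × ℕ × ℕ) (n j : ℕ) (h : n < hi ρ) :
    ∑ r ∈ Finset.range R, cnt R x0 l E ρ (n+1) (R * j + r) = cnt R x0 l E ρ n j := by
  classical
  unfold cnt
  obtain ⟨h', hh⟩ : ∃ h', hi ρ = n + 1 + h' := ⟨hi ρ - (n+1), by omega⟩
  have e1 : hi ρ - (n+1) = h' := by omega
  have e2 : hi ρ - n = h' + 1 := by omega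
  rw [e1, e2, pow_succ, mul_comm (R ^ h') R, sum_range_mul']
  refine Finset.sum_congr rfl fun r _ => Finset.sum_congr rfl fun u _ => ?_
  have : (R * j + r) * R ^ h' + u = j * (R * R ^ h') + (r * R ^ h' + u) := by ring
  rw [this]

theorem cnt_le (hR : 0 < R) (hl : 0 < l)
    (hE : ∀ i m k, ∀ y ∈ E i m k, ∀ y' ∈ E i m k, |y - y'| ≤ l / ((R:ℝ) ^ (i+1)) ^ m →
      |y - y'| ≤ l / ((R:ℝ) ^ (i+1)) ^ (m + k + 1))
    (ρ : ℕ × ℕ × ℕ) (j : ℕ) : cnt R x0 l E ρ (lo ρ) j ≤ 3 := by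
  classical
  unfold cnt
  rw [Finset.sum_boole]
  have hR0 : (0:ℝ) < R := by exact_mod_cast hR
  have := card_le_three ((Finset.range (R ^ (hi ρ - lo ρ))).filter fun u => hit R x0 l E ρ (j * R ^ (hi ρ - lo ρ) + u)) ?_
  · exact_mod_cast this
  obtain ⟨h, hh⟩ : ∃ h, hi ρ = lo ρ + h := ⟨hi ρ - lo ρ, by have := lo_lt_hi ρ; omega⟩
  have e1 : hi ρ - lo ρ = h := by omega
  rw [e1]
  have key : ∀ u < R ^ h, ∀ y : ℝ, x0 + l * (((j * R ^ h + u : ℕ):ℝ) / R ^ hi ρ) ≤ y → y ≤ x0 + l * ((((j * R ^ h + u : ℕ):ℝ) + 1) / R ^ hi ρ) →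
      x0 + l / R ^ (lo ρ) * j ≤ y ∧ y ≤ x0 + l / R ^ (lo ρ) * (j + 1) := by
    intro u hu y h1 h2
    have hu' : (u:ℝ) + 1 ≤ R ^ h := by exact_mod_cast hu
    constructor
    · refine le_trans ?_ h1
      rw [hh, pow_add, div_mul_eq_mul_div, mul_div_assoc]
      refine add_le_add_right (mul_le_mul_of_nonneg_left ?_ hl.le) x0
      rw [div_le_div_iff₀ (by positivity) (by positivity)]
      push_cast
      have : (0:ℝ) ≤ u * R ^ (lo ρ) := by positivity
      nlinarith
    · refine le_trans h2 ?_
      rw [hh, pow_add, div_mul_eq_mul_div, mul_div_assoc]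
      refine add_le_add_right (mul_le_mul_of_nonneg_left ?_ hl.le) x0
      rw [div_le_div_iff₀ (by positivity) (by positivity)]
      push_cast
      have : ((u:ℝ) + 1) * R ^ (lo ρ) ≤ R ^ h * R ^ (lo ρ) := by gcongr
      nlinarith
  intro u hu v hv
  simp only [Finset.mem_filter, Finset.mem_range] at hu hv
  obtain ⟨hu, y, hyE, hy1, hy2⟩ := hu
  obtain ⟨hv, z, hzE, hz1, hz2⟩ := hv
  obtain ⟨ky1, ky2⟩ := key u hu y hy1 hy2
  obtain ⟨kz1, kz2⟩ := key v hv z hz1 hz2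
  have hyz := hE ρ.1 ρ.2.2 ρ.2.1 y hyE z hzE (by
    rw [← pow_mul]
    change |y - z| ≤ l / R ^ (lo ρ)
    rw [abs_le]; constructor <;> linarith)
  rw [← pow_mul] at hyz
  change |y - z| ≤ l / R ^ (hi ρ) at hyz
  have h3 := (abs_le.mp hyz).2
  push_cast at hy1 hz2
  have h4 : l / R ^ (hi ρ) * (u:ℝ) ≤ l / R ^ (hi ρ) * ((v:ℝ) + 2) := by
    have e1 : l * ((j * (R:ℝ) ^ h + u) / R ^ hi ρ) = l / R ^ (hi ρ) * (j * (R:ℝ) ^ h) + l / R ^ (hi ρ) * u := by ring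
    have e2 : l * ((j * (R:ℝ) ^ h + v + 1) / R ^ hi ρ) = l / R ^ (hi ρ) * (j * (R:ℝ) ^ h) + l / R ^ (hi ρ) * (v + 1) := by ring
    rw [e1] at hy1
    rw [e2] at hz2
    linarith
  have h5 := le_of_mul_le_mul_left h4 (by positivity)
  exact_mod_cast h5

theorem term_sum (hR : 0 < R) (hγ : 0 < γ) (hl : 0 < l)
    (hE : ∀ i m k, ∀ y ∈ E i m k, ∀ y' ∈ E i m k, |y - y'| ≤ l / ((R:ℝ) ^ (i+1)) ^ m →
      |y - y'| ≤ l / ((R:ℝ) ^ (i+1)) ^ (m + k + 1))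
    (ρ : ℕ × ℕ × ℕ) (n j : ℕ) :
    ∑ r ∈ Finset.range R, term R γ x0 l E ρ (n+1) (R * j + r) ≤ γ * (term R γ x0 l E ρ n j + newt γ ρ n) := by
  unfold term
  by_cases h : lo ρ < n + 1 ∧ n + 1 ≤ hi ρ
  · simp only [if_pos h]
    rw [← Finset.sum_mul, cnt_sum ρ n j (by omega)]
    have hg : (γ:ENNReal)⁻¹ ^ (hi ρ - (n+1)) = γ * (γ:ENNReal)⁻¹ ^ (hi ρ - n) := by
      have : hi ρ - n = (hi ρ - (n+1)) + 1 := by omega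
      rw [this, pow_succ, mul_comm _ (γ:ENNReal)⁻¹, ← mul_assoc, ENNReal.mul_inv_cancel (by exact_mod_cast hγ.ne') (by simp), one_mul]
    rw [hg, mul_left_comm]
    refine mul_le_mul_right ?_ _
    by_cases h1 : lo ρ < n
    · rw [if_pos ⟨h1, by omega⟩]; exact le_self_add
    · have h2 : lo ρ = n := by omega
      unfold newt
      rw [if_pos h2]
      refine le_trans ?_ le_add_self
      have := cnt_le (x0 := x0) hR hl hE ρ j
      rw [h2] at this
      gcongr
  · simp only [if_neg h, Finset.sum_const_zero, zero_le]

theorem newt_sum (hγ : 24 ≤ γ) (n : ℕ) : ∑' ρ, newt γ ρ n ≤ 1 / 2 := by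
  rw [ENNReal.tsum_prod']
  set x : ENNReal := (γ:ENNReal)⁻¹ with hx
  have hx24 : x ≤ 24⁻¹ := by
    rw [hx, ENNReal.inv_le_inv]; exact_mod_cast hγ
  have hx1 : x ≤ 1 := hx24.trans (by rw [ENNReal.inv_le_one]; norm_num)
  have h1 : ∀ i, ∑' σ : ℕ × ℕ, newt γ (i, σ) n ≤ ∑' k : ℕ, 3 * x * x ^ i * x ^ k := by
    intro i
    rw [ENNReal.tsum_prod']
    refine ENNReal.tsum_le_tsum fun k => ?_
    calc ∑' m, newt γ (i, k, m) n ≤ ∑' m, if m = n / (i+1) then 3 * x * x ^ i * x ^ k else 0 := by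
          refine ENNReal.tsum_le_tsum fun m => ?_
          unfold newt
          by_cases h : lo (i, k, m) = n
          · have hm : m = n / (i+1) := by
              rw [← h]; simp [lo]
            rw [if_pos h, if_pos hm, mul_assoc, mul_assoc, ← pow_add, ← pow_succ']
            refine mul_le_mul_right ?_ _
            refine pow_le_pow_of_le_one (zero_le) hx1 ?_
            rw [← h]; simp only [lo, hi]
            have : (i + 1) * (m + k + 1) - (i+1) * m = (i+1) * (k+1) := by
              rw [← Nat.mul_sub]; congr 1; omega
            rw [this]; nlinarith [Nat.zero_le (i * k)]
          · rw [if_neg h]; exact zero_le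
      _ = 3 * x * x ^ i * x ^ k := tsum_ite_eq _ _
  refine (ENNReal.tsum_le_tsum h1).trans ?_
  simp_rw [ENNReal.tsum_mul_left, ENNReal.tsum_mul_right, ENNReal.tsum_mul_left, ENNReal.tsum_geometric]
  have h2 : (1 - x)⁻¹ ≤ 2 := by
    rw [ENNReal.inv_le_iff_inv_le]
    have h3 : (2:ENNReal)⁻¹ = 1 - 2⁻¹ := by
      rw [ENNReal.one_sub_inv_two]
    rw [h3]
    refine tsub_le_tsub_left (hx24.trans ?_) _
    rw [ENNReal.inv_le_inv]; norm_num
  calc 3 * x * (1 - x)⁻¹ * (1 - x)⁻¹ ≤ 3 * 24⁻¹ * 2 * 2 := by gcongr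
    _ = 1 / 2 := by
      have : (24:ENNReal) = 12 * 2 := by norm_num
      rw [this, ENNReal.mul_inv (by norm_num) (by norm_num)]
      have h12 : (3:ENNReal) * (12⁻¹ * 2⁻¹) * 2 * 2 = (12 * 12⁻¹) * 2⁻¹ := by ring
      rw [h12, ENNReal.mul_inv_cancel (by norm_num) (by norm_num)]; simp

theorem pot_sum (hR : 0 < R) (hγ : 24 ≤ γ) (hl : 0 < l)
    (hE : ∀ i m k, ∀ y ∈ E i m k, ∀ y' ∈ E i m k, |y - y'| ≤ l / ((R:ℝ) ^ (i+1)) ^ m →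
      |y - y'| ≤ l / ((R:ℝ) ^ (i+1)) ^ (m + k + 1)) (n j : ℕ) (hg : pot R γ x0 l E n j ≤ 1 / 2) :
    ∑ r ∈ Finset.range R, pot R γ x0 l E (n+1) (R * j + r) ≤ γ := by
  unfold pot at hg ⊢
  rw [← Summable.tsum_finsetSum (fun _ _ => ENNReal.summable)]
  refine (ENNReal.tsum_le_tsum fun ρ => term_sum hR (by omega) hl hE ρ n j).trans ?_
  rw [ENNReal.tsum_mul_left, ENNReal.tsum_add]
  calc (γ:ENNReal) * (∑' ρ, term R γ x0 l E ρ n j + ∑' ρ, newt γ ρ n) ≤ γ * (1/2 + 1/2) := by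
        gcongr; exact newt_sum hγ n
    _ = γ := by rw [ENNReal.add_halves, mul_one]

theorem pot_children (hR : R = 4 * γ) (hγ : 24 ≤ γ) (hl : 0 < l)
    (hE : ∀ i m k, ∀ y ∈ E i m k, ∀ y' ∈ E i m k, |y - y'| ≤ l / ((R:ℝ) ^ (i+1)) ^ m →
      |y - y'| ≤ l / ((R:ℝ) ^ (i+1)) ^ (m + k + 1)) (n j : ℕ) (hg : pot R γ x0 l E n j ≤ 1 / 2) :
    ∃ f : ℕ → ℕ, (∀ d < 2 * γ, f d < R ∧ pot R γ x0 l E (n+1) (R * j + f d) ≤ 1 / 2) ∧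
      ∀ d < 2 * γ, ∀ d' < 2 * γ, f d = f d' → d = d' := by
  classical
  have hs := pot_sum (by omega) hγ hl hE n j hg
  set S := (Finset.range R).filter fun r => pot R γ x0 l E (n+1) (R * j + r) ≤ 1 / 2
  set T := (Finset.range R).filter fun r => ¬ pot R γ x0 l E (n+1) (R * j + r) ≤ 1 / 2 with hT
  have hST : S.card + T.card = R := by
    rw [Finset.card_filter_add_card_filter_not]; simp
  have hTc : T.card ≤ 2 * γ := by
    have h1 : T.card • (1/2 : ENNReal) ≤ γ := by
      refine (Finset.card_nsmul_le_sum T (fun r => pot R γ x0 l E (n+1) (R * j + r)) _ ?_).trans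
        ((Finset.sum_le_sum_of_subset (Finset.filter_subset _ _)).trans hs)
      intro r hr
      rw [hT, Finset.mem_filter] at hr
      exact (not_le.mp hr.2).le
    rw [nsmul_eq_mul, one_div, ← div_eq_mul_inv, ENNReal.div_le_iff (by norm_num) (by norm_num)] at h1
    have h2 : T.card ≤ γ * 2 := by exact_mod_cast h1
    omega
  have hSc : 2 * γ ≤ S.card := by omega
  let emb := S.orderEmbOfCardLe hSc
  have hmem : ∀ a, emb a ∈ S := fun a => Finset.orderEmbOfCardLe_mem S hSc a
  refine ⟨fun d => if h : d < 2 * γ then emb ⟨d, h⟩ else 0, ?_, ?_⟩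
  · intro d hd
    simp only [dif_pos hd]
    have := hmem ⟨d, hd⟩
    simp only [S, Finset.mem_filter, Finset.mem_range] at this
    exact this
  · intro d hd d' hd' h
    simp only [dif_pos hd, dif_pos hd'] at h
    have := emb.injective h
    simpa using this

theorem pot_zero : pot R γ x0 l E 0 0 ≤ 1 / 2 := by
  unfold pot term; simp

theorem pot_hit (ρ : ℕ × ℕ × ℕ) (j : ℕ) (h : hit R x0 l E ρ j) : ¬ pot R γ x0 l E (hi ρ) j ≤ 1 / 2 := by
  intro hle
  have h1 : term R γ x0 l E ρ (hi ρ) j ≤ 1 / 2 := (ENNReal.le_tsum ρ).trans hle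
  unfold term cnt at h1
  rw [if_pos ⟨lo_lt_hi ρ, le_rfl⟩] at h1
  simp only [Nat.sub_self, pow_zero, Finset.range_one, Finset.sum_singleton, mul_one] at h1
  have h' : hit R x0 l E ρ (j * R ^ (hi ρ - hi ρ) + 0) := by simpa using h
  have h2 : hit R x0 l E ρ (j + 0) := by simpa using h
  first
    | rw [if_pos h'] at h1
    | rw [if_pos h] at h1
    | rw [if_pos h2] at h1
  rw [one_div, ENNReal.one_le_inv] at h1
  norm_num at h1

end pot

theorem exists_gamma {d : ℝ} (hd : d < 1) : ∃ γ : ℕ, 24 ≤ γ ∧ ((4 * γ : ℕ) : ℝ) ^ d ≤ (2 * γ : ℕ) := by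
  have h1 : Filter.Tendsto (fun γ : ℕ => ((4 * γ : ℕ) : ℝ) ^ (1 - d)) Filter.atTop Filter.atTop := by
    refine (tendsto_rpow_atTop (by linarith)).comp ?_
    refine tendsto_natCast_atTop_atTop.comp ?_
    exact Filter.tendsto_id.const_mul_atTop' (by norm_num)
  obtain ⟨γ, h2, h3⟩ := ((h1.eventually_ge_atTop 2).and (Filter.eventually_ge_atTop 24)).exists
  refine ⟨γ, h3, ?_⟩
  have hpos : (0:ℝ) < ((4 * γ : ℕ) : ℝ) := by exact_mod_cast (by omega : 0 < 4 * γ)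
  have h4 : ((4 * γ : ℕ) : ℝ) ^ d * ((4 * γ : ℕ) : ℝ) ^ (1 - d) = (4 * γ : ℕ) := by
    rw [← Real.rpow_add hpos]; simp
  have h5 : ((4 * γ : ℕ) : ℝ) ^ d * 2 ≤ (4 * γ : ℕ) := by
    calc ((4 * γ : ℕ) : ℝ) ^ d * 2 ≤ ((4 * γ : ℕ) : ℝ) ^ d * ((4 * γ : ℕ) : ℝ) ^ (1 - d) :=
          mul_le_mul_of_nonneg_left h2 (Real.rpow_nonneg hpos.le _)
      _ = _ := h4
  push_cast at h5 ⊢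
  linarith

theorem thick_of_cover (X : ℕ → Set ℝ)
    (hX : ∀ i, ∀ R l : ℝ, 16 < R → 0 < l → ∃ E : ℕ → ℕ → Set ℝ, (∀ y, y ∉ X i → ∃ m k, y ∈ E m k) ∧
      ∀ m k, ∀ y ∈ E m k, ∀ y' ∈ E m k, |y - y'| ≤ l / R ^ m → |y - y'| ≤ l / R ^ (m + k + 1))
    (a b : ℝ) (hab : a < b) : dimH (Set.Ioo a b ∩ ⋂ i, X i) = 1 := by
  refine le_antisymm ((dimH_mono (Set.subset_univ _)).trans Real.dimH_univ.le) ?_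
  refine ENNReal.le_of_forall_nnreal_lt fun d hd => ?_
  have hd1 : d < 1 := by exact_mod_cast hd
  rcases eq_or_ne d 0 with rfl | hd0
  · simp
  obtain ⟨γ, hγ, hγd⟩ := exists_gamma (d := d) (by exact_mod_cast hd1)
  set l := (b - a) / 3 with hl
  set x0 := a + l with hx0
  have hlp : 0 < l := by rw [hl]; linarith
  set R := 4 * γ with hR
  have hRR : (16:ℝ) < R := by exact_mod_cast (by omega : 16 < R)
  have hRi : ∀ i : ℕ, (16:ℝ) < (R:ℝ) ^ (i+1) := by
    intro i
    exact lt_of_lt_of_le hRR (le_self_pow₀ (by linarith) (by omega))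
  choose E hE1 hE2 using fun i => hX i ((R:ℝ) ^ (i+1)) l (hRi i) hlp
  refine cantor_dim (R := R) (N := 2 * γ) (by omega) (by omega) (Good := fun n j => pot R γ x0 l E n j ≤ 1/2 ∧ j < R ^ n)
    ⟨pot_zero, by simp⟩ ?_ hlp (x0 := x0) (pos_iff_ne_zero.mpr hd0) hγd ?_
  · rintro n j ⟨hg, hj⟩
    obtain ⟨f, hf1, hf2⟩ := pot_children hR hγ hlp hE2 n j hg
    refine ⟨f, fun d hd => ⟨(hf1 d hd).1, (hf1 d hd).2, ?_⟩, hf2⟩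
    have h1 := (hf1 d hd).1
    rw [pow_succ]
    nlinarith
  intro y hy
  refine ⟨?_, ?_⟩
  · obtain ⟨j, ⟨-, hj⟩, h1, h2⟩ := hy 0
    have hj0 : j = 0 := by simpa using hj
    subst hj0
    simp at h1 h2
    constructor <;> linarith
  · rw [Set.mem_iInter]
    intro i
    by_contra hcon
    obtain ⟨m, k, hmk⟩ := hE1 i y hcon
    obtain ⟨j, hj, h1, h2⟩ := hy (hi (i, k, m))
    exact pot_hit (i, k, m) j ⟨y, hmk, h1, h2⟩ hj.1

/-- Badziahin–Pollington–Velani: if `s_n + t_n = 1`, `liminf min(s_n,t_n) > 0`,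
`s = sup_n s_n` and `inf_{q ≥ 1} q^(1/s) ‖qθ‖ > 0` (vacuous for `s = 0`), then
`⋂ₙ Bad(s_n,t_n;θ)` is thick in `ℝ`: its intersection with every nonempty open
interval has Hausdorff dimension `1`. -/
theorem bpv_thick (sn tn : ℕ → ℝ) (hs : ∀ n, 0 ≤ sn n) (ht : ∀ n, 0 ≤ tn n)
    (hst : ∀ n, sn n + tn n = 1)
    (hliminf : 0 < Filter.atTop.liminf fun n => min (sn n) (tn n))
    (θ : ℝ)
    (hθ : (⨆ n, sn n) ≠ 0 →
      0 < ⨅ q : {q : ℕ // 0 < q}, (q : ℝ) ^ (1 / ⨆ n, sn n) * dInt ((q : ℝ) * θ)) :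
    ∀ a b : ℝ, a < b →
      dimH (Set.Ioo a b ∩ ⋂ n : ℕ, BadST (sn n) (tn n) θ) = 1 := by
  have hbdd : BddAbove (Set.range sn) := ⟨1, by rintro _ ⟨n, rfl⟩; linarith [ht n, hst n]⟩
  have hle : ∀ n, sn n ≤ ⨆ n, sn n := fun n => le_ciSup hbdd n
  have hS0 : (⨆ n, sn n) ≠ 0 := by
    intro h0
    have hz : ∀ n, min (sn n) (tn n) = 0 := by
      intro n
      have h1 : sn n = 0 := le_antisymm (h0 ▸ hle n) (hs n)
      rw [h1]; exact min_eq_left (ht n)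
    simp [hz] at hliminf
  have hpos := hθ hS0
  have hS1 : (⨆ n, sn n) ≤ 1 := ciSup_le fun n => by linarith [ht n, hst n]
  set S := ⨆ n, sn n with hS
  have hSp : 0 < S := lt_of_le_of_ne ((hs 0).trans (hle 0)) hS0.symm
  set c0 := ⨅ q : {q : ℕ // 0 < q}, (q : ℝ) ^ (1 / S) * dInt ((q : ℝ) * θ) with hc0
  have hdn : ∀ x, 0 ≤ dInt x := fun x => by rw [dInt_eq]; exact abs_nonneg _
  have hc : ∀ q : ℕ, 0 < q → c0 ≤ (q : ℝ) ^ (1 / S) * dInt ((q : ℝ) * θ) := by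
    intro q hq
    exact ciInf_le (f := fun q : {q : ℕ // 0 < q} => ((q : ℕ) : ℝ) ^ (1 / S) * dInt (((q : ℕ) : ℝ) * θ))
      ⟨0, by rintro _ ⟨q, rfl⟩; exact mul_nonneg (by positivity) (hdn _)⟩ ⟨q, hq⟩
  refine thick_of_cover _ fun i R l hR hl => ?_
  rcases (ht i).eq_or_lt with h0 | htp
  · -- `t = 0`, `s = 1`: everything is in the set
    have hs1 : sn i = 1 := by linarith [hst i]
    have hS1' : S = 1 := le_antisymm hS1 (hs1 ▸ hle i)
    refine ⟨fun _ _ => ∅, fun y hy => ?_, fun m k y hy => absurd hy (Set.notMem_empty _)⟩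
    exfalso
    apply hy
    have : Nonempty {q : ℕ // 0 < q} := ⟨⟨1, one_pos⟩⟩
    refine lt_of_lt_of_le hpos (le_ciInf fun q => ?_)
    refine le_trans ?_ (le_max_left _ _)
    have := hc q q.2
    rw [hS1'] at this
    rw [hs1]
    simpa using this
  · refine bad_cover (hs i) htp (hst i) hpos ?_ hR hl
    intro q hq A C hA hAq
    have hq1 : (1:ℝ) ≤ q := by exact_mod_cast hq
    have hn : 0 < A.natAbs := Int.natAbs_pos.mpr hA
    have hnat : ((A.natAbs : ℕ) : ℝ) = |(A:ℝ)| := by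
      rw [Nat.cast_natAbs]; push_cast; rfl
    have h1 := hc A.natAbs hn
    rw [hnat] at h1
    have h2 : |(A:ℝ)| ^ (1 / S) ≤ q := by
      calc |(A:ℝ)| ^ (1 / S) ≤ ((q:ℝ) ^ S) ^ (1 / S) := by
            apply Real.rpow_le_rpow (abs_nonneg _) _ (by positivity)
            exact hAq.trans (Real.rpow_le_rpow_of_exponent_le hq1 (hle i))
        _ = q := by
            rw [← Real.rpow_mul (by linarith), mul_one_div_cancel hS0, Real.rpow_one]
    have h3 : dInt (|(A:ℝ)| * θ) ≤ |A * θ + C| := by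
      rcases abs_choice (A:ℝ) with h | h
      · rw [h]
        have := dInt_le (A * θ) (-C)
        push_cast at this
        rwa [sub_neg_eq_add] at this
      · rw [h]
        have := dInt_le (-A * θ) C
        rw [← abs_neg] at this
        convert this using 2; ring
    rw [div_le_iff₀ (by linarith)]
    calc c0 ≤ |(A:ℝ)| ^ (1 / S) * dInt (|(A:ℝ)| * θ) := h1
      _ ≤ q * |A * θ + C| := by
        gcongr
        exact hdn _
      _ = _ := by ring
end
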